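/- arXiv:2407.16093 — 7 statements merged into one kernel-verified Lean document; each statement's English description precedes it below -/
import Mathlib

section
/- Re-rooting identity across the pinned edge: r(a,b) · τ_a^{∥{−1}} = r(b,a) · τ_b^{∥{+1}}, i.e. the weighted sum over spanning trees rooted at a containing the edge (b,a), multiplied by r(a,b), equals the weighted sum over spanning trees rooted at b containing the edge (a,b), multiplied by r(b,a). -/
open scoped Classical

noncomputable section

/-- A rooted spanning tree with root `x`: a map `t : X → X` fixing `x` such that every
vertex reaches `x` under iteration of `t`. -/
def IsRootedTree {X : Type*} (x : X) (t : X → X) : Prop :=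
  t x = x ∧ ∀ y : X, ∃ n : ℕ, t^[n] y = x

/-- The edge set of a rooted spanning tree: `{(y, t y) : y ≠ x}`. -/
def treeEdges {X : Type*} (x : X) (t : X → X) : Set (X × X) :=
  {p : X × X | p.1 ≠ x ∧ p.2 = t p.1}

/-- The weight of a rooted spanning tree: `∏_{y ≠ x} r (y, t y)`. -/
def treeWeight {X : Type*} [Fintype X] (r : X × X → ℝ) (x : X) (t : X → X) : ℝ :=
  ∏ y ∈ Finset.univ.filter (fun y => y ≠ x), r (y, t y)

/-- The conditioned rooted spanning-tree polynomial `τ_x^{∖A ∥B}`: the sum of weights of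
rooted spanning trees with root `x` avoiding all edges of `A` and containing all edges of `B`. -/
def tau {X : Type*} [Fintype X] (r : X × X → ℝ) (x : X) (A B : Set (X × X)) : ℝ :=
  ∑ t : X → X,
    if IsRootedTree x t ∧ treeEdges x t ∩ A = ∅ ∧ B ⊆ treeEdges x t
    then treeWeight r x t else 0

/-- Irreducibility: between any two distinct vertices there is a directed path of
present (positive-rate) edges. -/
def Irreducible' {X : Type*} (r : X × X → ℝ) : Prop :=
  ∀ x y : X, x ≠ y → ∃ (n : ℕ) (f : ℕ → X),
    f 0 = x ∧ f n = y ∧ ∀ i < n, 0 < r (f i, f (i + 1))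

lemma flip_aux {X : Type*} (a b : X) (hab : a ≠ b) (t : X → X)
    (h : IsRootedTree a t) :
    IsRootedTree b (Function.update (Function.update t b b) a b) := by
  refine ⟨by simp [Function.update_apply], fun y => ?_⟩
  obtain ⟨n, hn⟩ := h.2 y
  induction n generalizing y with
  | zero => exact ⟨1, by simp at hn; simp [hn]⟩
  | succ n ih =>
    by_cases hb : y = b
    · exact ⟨0, by simpa using hb⟩
    by_cases ha : y = a
    · exact ⟨1, by simp [ha]⟩
    obtain ⟨m, hm⟩ := ih (t y) (by simpa using hn)
    refine ⟨m + 1, ?_⟩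
    rw [Function.iterate_succ_apply, Function.update_of_ne ha, Function.update_of_ne hb]
    exact hm

lemma weight_aux {X : Type*} [Fintype X] (r : X × X → ℝ) (a b : X) (hab : a ≠ b) (t : X → X)
    (h : t b = a) : treeWeight r a t
      = r (b, a) * ∏ y ∈ (Finset.univ.erase a).erase b, r (y, t y) := by
  have : (Finset.univ.filter (fun y => y ≠ a)) = Finset.univ.erase a := by ext; simp
  rw [treeWeight, this, ← Finset.mul_prod_erase _ _ (a := b) (by simp [hab.symm]), h]

lemma cond_aux {X : Type*} (a b : X) (hab : a ≠ b) (t : X → X) :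
    (IsRootedTree a t ∧ treeEdges a t ∩ ∅ = ∅ ∧ {(b, a)} ⊆ treeEdges a t)
      ↔ (IsRootedTree a t ∧ t b = a) := by
  simp [treeEdges, eq_comm]
  exact fun _ _ => hab

lemma inv_aux {X : Type*} (a b : X) (hab : a ≠ b) (t : X → X) (ha : t a = a) (hb : t b = a) :
    Function.update (Function.update
      (Function.update (Function.update t b b) a b) a a) b a = t := by
  funext y
  simp only [Function.update_apply]
  grind

theorem stmt_5 {X : Type*} [Fintype X] (r : X × X → ℝ) (hr : ∀ e, 0 ≤ r e)
    (a b : X) (hab : a ≠ b) (hpab : 0 < r (a, b)) (hpba : 0 < r (b, a)) :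
    r (a, b) * tau r a ∅ {(b, a)} = r (b, a) * tau r b ∅ {(a, b)} := by
  simp only [tau, cond_aux a b hab, cond_aux b a hab.symm]
  rw [← Finset.sum_filter, ← Finset.sum_filter, Finset.mul_sum, Finset.mul_sum]
  refine Finset.sum_bij' (fun t _ => Function.update (Function.update t b b) a b)
    (fun t _ => Function.update (Function.update t a a) b a) ?_ ?_ ?_ ?_ ?_
  · intro t ht
    simp only [Finset.mem_filter, Finset.mem_univ, true_and] at ht ⊢
    exact ⟨flip_aux a b hab t ht.1, by simp⟩
  · intro t ht
    simp only [Finset.mem_filter, Finset.mem_univ, true_and] at ht ⊢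
    exact ⟨flip_aux b a hab.symm t ht.1, by simp⟩
  · intro t ht
    simp only [Finset.mem_filter, Finset.mem_univ, true_and] at ht
    exact inv_aux a b hab t ht.1.1 ht.2
  · intro t ht
    simp only [Finset.mem_filter, Finset.mem_univ, true_and] at ht
    exact inv_aux b a hab.symm t ht.1.1 ht.2
  · intro t ht
    simp only [Finset.mem_filter, Finset.mem_univ, true_and] at ht
    rw [weight_aux r a b hab t ht.2, weight_aux r b a hab.symm _ (by simp),
      Finset.erase_right_comm (a := b) (b := a), mul_left_comm]
    congr 2
    refine Finset.prod_congr rfl fun y hy => ?_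
    simp only [Finset.mem_erase] at hy
    rw [Function.update_of_ne hy.2.1, Function.update_of_ne hy.1]
end
end

section
/- Second-order deletion-constriction (Theorem 2): for every vertex x ∈ X, r(b,a) · τ_b^{∥{+1}} · τ_x^{∖{+1,−1}} = r(a,b) · τ_a^{∖{+1,−1}} · τ_x^{∖{+1} ∥{−1}} + r(b,a) · τ_b^{∖{+1,−1}} · τ_x^{∖{−1} ∥{+1}}. (Here r(b,a)·τ_b^{∥{+1}} equals r(+1)r(−1) times the spanning-tree polynomial of the graph with the pinned edge contracted, by the re-rooting identity.) -/
open scoped Classical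

noncomputable section

/-- `v` reaches the set `C` under iteration of `u`. -/
def Rch {X : Type*} (u : X → X) (C : Set X) (v : X) : Prop := ∃ n : ℕ, u^[n] v ∈ C

theorem rch_self {X : Type*} {u : X → X} {C : Set X} {v : X} (h : v ∈ C) : Rch u C v := ⟨0, h⟩

theorem rch_step {X : Type*} {u : X → X} {C : Set X} {v : X} (h : Rch u C (u v)) : Rch u C v := by
  obtain ⟨n, hn⟩ := h
  exact ⟨n + 1, by simpa using hn⟩

theorem rch_iter {X : Type*} {u : X → X} {C : Set X} {v : X} (n : ℕ)
    (h : Rch u C (u^[n] v)) : Rch u C v := by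
  obtain ⟨m, hm⟩ := h
  exact ⟨m + n, by rw [Function.iterate_add_apply]; exact hm⟩

theorem rch_cases {X : Type*} {u : X → X} {C : Set X} {v : X} (h : Rch u C v) :
    v ∈ C ∨ Rch u C (u v) := by
  obtain ⟨n, hn⟩ := h
  cases n with
  | zero => exact Or.inl hn
  | succ n => exact Or.inr ⟨n, by simpa using hn⟩

theorem rch_trans {X : Type*} {u : X → X} {C : Set X} {v w : X} (h : Rch u {w} v)
    (h2 : Rch u C w) : Rch u C v := by
  obtain ⟨n, hn⟩ := h
  exact rch_iter n (by rw [Set.mem_singleton_iff.1 hn]; exact h2)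

theorem rch_mono {X : Type*} {u : X → X} {C D : Set X} {v : X} (h : Rch u C v)
    (h2 : ∀ w ∈ C, Rch u D w) : Rch u D v := by
  obtain ⟨n, hn⟩ := h
  exact rch_iter n (h2 _ hn)

theorem rch_update {X : Type*} {u : X → X} {C : Set X} {y : X} (hy : y ∈ C) (z : X) {v : X}
    (h : Rch u C v) : Rch (Function.update u y z) C v := by
  obtain ⟨n, hn⟩ := h
  induction n generalizing v with
  | zero => exact ⟨0, hn⟩
  | succ n ih =>
    by_cases hv : v = y
    · exact ⟨0, by simpa [hv] using hy⟩
    · apply rch_step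
      rw [Function.update_of_ne hv]
      exact ih (by simpa using hn)

/-- A set of fixed points is absorbing. -/
theorem rch_fixed {X : Type*} {u : X → X} {C : Set X} {v : X} (hv : u v = v)
    (h : Rch u C v) : v ∈ C := by
  obtain ⟨n, hn⟩ := h
  rwa [Function.iterate_fixed hv] at hn

/-- On a cycle: if `y` returns to itself and `y` reaches `w`, then `w` reaches `y`. -/
theorem rch_cycle {X : Type*} {u : X → X} {y w : X} (h : Rch u {y} (u y))
    (hw : Rch u {w} y) : Rch u {y} w := by
  obtain ⟨n, hn⟩ := h
  obtain ⟨m, hm⟩ := hw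
  have hm : u^[m] y = w := hm
  have hn : u^[n+1] y = y := by simpa using hn
  have key : ∀ k, u^[k * (n+1)] y = y := by
    intro k
    rw [mul_comm, Function.iterate_mul]
    exact Function.iterate_fixed hn k
  refine ⟨m * n, ?_⟩
  rw [← hm, ← Function.iterate_add_apply]
  have : m * n + m = m * (n+1) := by ring
  rw [this]
  exact key m

/-- On a cycle, the predecessor is unique. -/
theorem pred_unique {X : Type*} {u : X → X} {y x₁ x₂ : X} (h1 : u x₁ = y) (h2 : u x₂ = y)
    (r1 : Rch u {x₁} y) (r2 : Rch u {x₂} y) : x₁ = x₂ := by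
  obtain ⟨n, hn⟩ := r1
  obtain ⟨m, hm⟩ := r2
  have hn : u^[n] y = x₁ := hn
  have hm : u^[m] y = x₂ := hm
  have pn : u^[n+1] y = y := by rw [Function.iterate_succ_apply', hn, h1]
  have pm : u^[m+1] y = y := by rw [Function.iterate_succ_apply', hm, h2]
  have e1 : u^[m + (m+1)*n] y = x₂ := by
    rw [Function.iterate_add_apply, Function.iterate_mul, Function.iterate_fixed pm, hm]
  have e2 : u^[n + (n+1)*m] y = x₁ := by
    rw [Function.iterate_add_apply, Function.iterate_mul, Function.iterate_fixed pn, hn]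
  rw [← e1, ← e2]
  congr 1
  ring_nf

theorem fixed_unique {X : Type*} {u : X → X} {a x b : X} (hx : u x = x) (hb : u b = b)
    (h1 : Rch u {x} a) (h2 : Rch u {b} a) : x = b := by
  obtain ⟨n, hn⟩ := h1
  obtain ⟨m, hm⟩ := h2
  have hn : u^[n] a = x := hn
  have hm : u^[m] a = b := hm
  have e1 : u^[m + n] a = x := by
    rw [Function.iterate_add_apply, hn, Function.iterate_fixed hx]
  have e2 : u^[n + m] a = b := by
    rw [Function.iterate_add_apply, hm, Function.iterate_fixed hb]
  rw [← e1, ← e2, add_comm]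

/-- Condition defining the forests in `GG`. -/
def PP {X : Type*} (B : Set X) (a x : X) (u : X → X) : Prop :=
  x ∉ B ∧ (∀ c ∈ B, u c = c) ∧ (∀ v, Rch u (insert x B) v) ∧ Rch u {x} a

def TT {X : Type*} (B : Set X) (u : X → X) : Prop :=
  (∀ c ∈ B, u c = c) ∧ (∀ v, Rch u B v)

theorem PP_update1 {X : Type*} {B : Set X} {a x : X} {u : X → X} (z : X) (h : PP B a x u) :
    PP B a x (Function.update u x z) := by
  obtain ⟨h1, h2, h3, h4⟩ := h
  refine ⟨h1, ?_, fun v => rch_update (Set.mem_insert _ _) z (h3 v), rch_update (Set.mem_singleton _) z h4⟩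
  intro c hc
  rw [Function.update_of_ne (by rintro rfl; exact h1 hc)]
  exact h2 c hc

theorem PP_update {X : Type*} {B : Set X} {a x : X} {u : X → X} (z : X) :
    PP B a x (Function.update u x z) ↔ PP B a x u := by
  refine ⟨fun h => ?_, PP_update1 z⟩
  have := PP_update1 (u x) h
  simpa using this

/-- A fixed point set absorbs. -/
theorem not_fixed_rch {X : Type*} {B : Set X} {u : X → X} (hB : ∀ c ∈ B, u c = c) {y x : X}
    (hx : x ∉ B) (hyx : Rch u {x} y) (hxy : Rch u {y} (u x)) : ¬ Rch u B y := by
  rintro ⟨n, hn⟩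
  have hx' : Rch u {x} (u x) := rch_trans hxy hyx
  have h1 : Rch u {y} x := rch_step hxy
  have h2 : Rch u {u^[n] y} x := rch_trans h1 ⟨n, rfl⟩
  have h3 := rch_cycle hx' h2
  have := rch_fixed (hB _ hn) h3
  rw [Set.mem_singleton_iff] at this
  exact hx (this ▸ hn)

theorem PP_pred_unique {X : Type*} {B : Set X} {a y x₁ x₂ : X} {u : X → X}
    (h1 : u x₁ = y) (h2 : u x₂ = y) (p1 : PP B a x₁ u) (p2 : PP B a x₂ u) : x₁ = x₂ := by
  -- it suffices that `y` reaches both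
  obtain ⟨n, hn⟩ := p1.2.2.2
  obtain ⟨m, hm⟩ := p2.2.2.2
  have hn : u^[n] a = x₁ := hn
  have hm : u^[m] a = x₂ := hm
  have aux : ∀ {z w : X} {k l : ℕ}, u z = y → u w = y → PP B a z u → PP B a w u →
      u^[k] a = z → u^[l] a = w → k < l → z = w := by
    intro z w k l hz hw pz pw hk hl hkl
    obtain ⟨d, rfl⟩ := Nat.exists_eq_add_of_lt hkl
    have hyw : Rch u {w} y := by
      refine ⟨d, ?_⟩
      rw [← hl, ← hz, ← hk, ← Function.iterate_succ_apply, ← Function.iterate_add_apply]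
      congr 1
      rw [show d.succ + k = k + d + 1 by omega]
    have hnB : ¬ Rch u B y := by
      refine not_fixed_rch pw.2.1 pw.1 hyw ?_
      rw [hw]
      exact rch_self rfl
    refine pred_unique hz hw ?_ hyw
    obtain ⟨j, hj⟩ := pz.2.2.1 y
    rcases hj with hj | hj
    · exact ⟨j, hj⟩
    · exact absurd ⟨j, hj⟩ hnB
  rcases lt_trichotomy n m with h | h | h
  · exact aux h1 h2 p1 p2 hn hm h
  · rw [← hn, ← hm, h]
  · exact (aux h2 h1 p2 p1 hm hn h).symm

theorem PP_pred_exists {X : Type*} {B : Set X} {a y : X} {u : X → X}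
    (p : PP B a y u) (hnot : ¬ (y = a ∧ TT B u)) : ∃ x, u x = y ∧ PP B a x u := by
  obtain ⟨h1, h2, h3, h4⟩ := p
  by_cases hy : Rch u B y
  · have hall : ∀ v, Rch u B v := fun v => rch_mono (h3 v) (by
      rintro w (rfl | hw)
      · exact hy
      · exact rch_self hw)
    have hya : y ≠ a := fun h => hnot ⟨h, h2, hall⟩
    obtain ⟨n, hn⟩ := h4
    have hn : u^[n] a = y := hn
    cases n with
    | zero => exact absurd hn.symm hya
    | succ n =>
      rw [Function.iterate_succ_apply'] at hn
      refine ⟨_, hn, ?_, h2, fun v => rch_mono (hall v) fun w hw => rch_self (Or.inr hw), n, rfl⟩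
      intro hB
      rw [h2 _ hB] at hn
      exact h1 (hn ▸ hB)
  · obtain ⟨n, hn⟩ := h3 (u y)
    rcases hn with hn | hn
    · have hn' : u (u^[n] y) = y := by rw [← Function.iterate_succ_apply' u]; simpa using hn
      have hyx : Rch u {u^[n] y} y := ⟨n, rfl⟩
      refine ⟨u^[n] y, hn', ?_, h2, ?_, rch_trans h4 hyx⟩
      · intro hB
        exact hy ⟨n, hB⟩
      · intro v
        refine rch_mono (h3 v) ?_
        rintro w (rfl | hw)
        · exact ⟨n, Or.inl rfl⟩
        · exact rch_self (Or.inr hw)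
    · exact absurd (rch_step ⟨n, hn⟩) hy

theorem PP_of_pred {X : Type*} {B : Set X} {a x y : X} {u : X → X} (hy : y ∉ B)
    (hx : u x = y) (p : PP B a x u) : PP B a y u ∧ ¬ (y = a ∧ TT B u) := by
  obtain ⟨h1, h2, h3, h4⟩ := p
  have hxy : Rch u {y} x := ⟨1, by simpa using hx⟩
  refine ⟨⟨hy, h2, ?_, rch_trans h4 hxy⟩, ?_⟩
  · intro v
    refine rch_mono (h3 v) ?_
    rintro w (rfl | hw)
    · exact rch_mono hxy fun w hw => rch_self (Or.inl hw)
    · exact rch_self (Or.inr hw)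
  · rintro ⟨rfl, ht⟩
    exact not_fixed_rch h2 h1 h4 (by rw [hx]; exact rch_self rfl) (ht.2 y)

theorem PP_of_TT {X : Type*} {B : Set X} {a : X} {u : X → X} (ha : a ∉ B) (h : TT B u) :
    PP B a a u :=
  ⟨ha, h.1, fun v => rch_mono (h.2 v) fun w hw => rch_self (Or.inr hw), rch_self rfl⟩

theorem count {X : Type*} [Fintype X] {B : Set X} {a y : X} (hy : y ∉ B) (u : X → X) :
    (∑ x, if u x = y ∧ PP B a x u then (1:ℝ) else 0) =
      (if PP B a y u then 1 else 0) - (if y = a ∧ TT B u then 1 else 0) := by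
  by_cases hex : ∃ x, u x = y ∧ PP B a x u
  · obtain ⟨x, hx, p⟩ := hex
    have h := PP_of_pred hy hx p
    rw [if_pos h.1, if_neg h.2, Finset.sum_eq_single x]
    · rw [if_pos ⟨hx, p⟩]; simp
    · intro z _ hz
      rw [if_neg]
      rintro ⟨hz1, hz2⟩
      exact hz (PP_pred_unique hz1 hx hz2 p)
    · simp
  · rw [Finset.sum_eq_zero]
    · by_cases hP : PP B a y u
      · have : y = a ∧ TT B u := by
          by_contra h
          exact hex (PP_pred_exists hP h)
        rw [if_pos hP, if_pos this]; simp
      · rw [if_neg hP, if_neg]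
        · simp
        · rintro ⟨rfl, h⟩
          exact hP (PP_of_TT hy h)
    · intro x _
      rw [if_neg]
      intro h
      exact hex ⟨x, h⟩

/-- Weight with roots in `B`. -/
def WW {X : Type*} [Fintype X] (s : X × X → ℝ) (B : Set X) (t : X → X) : ℝ :=
  ∏ y ∈ Finset.univ.filter (fun y => y ∉ B), s (y, t y)

def GG {X : Type*} [Fintype X] (s : X × X → ℝ) (B : Set X) (a x : X) : ℝ :=
  ∑ t : X → X, if t x = x ∧ PP B a x t then WW s (insert x B) t else 0

def TB {X : Type*} [Fintype X] (s : X × X → ℝ) (B : Set X) : ℝ :=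
  ∑ t : X → X, if TT B t then WW s B t else 0

theorem WW_insert {X : Type*} [Fintype X] (s : X × X → ℝ) {B : Set X} {x : X} (hx : x ∉ B)
    (u : X → X) (z : X) :
    WW s B u = s (x, u x) * WW s (insert x B) (Function.update u x z) := by
  unfold WW
  rw [← Finset.mul_prod_erase _ _ (a := x) (by simp [hx])]
  congr 1
  apply Finset.prod_congr
  · ext y; simp [and_comm]
  · intro y hy
    have : y ≠ x := by rintro rfl; simp at hy
    rw [Function.update_of_ne this]

theorem sum_update {X : Type*} [Fintype X] (x z z' : X) (f : (X → X) → ℝ) :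
    (∑ t : X → X, if t x = z' then f t else 0) =
      ∑ u : X → X, if u x = z then f (Function.update u x z') else 0 := by
  rw [← Finset.sum_filter, ← Finset.sum_filter]
  refine Finset.sum_bij' (fun t _ => Function.update t x z) (fun u _ => Function.update u x z')
    ?_ ?_ ?_ ?_ ?_
  · intro t ht; simp
  · intro t ht; simp
  · intro t ht
    simp only [Finset.mem_filter, Finset.mem_univ, true_and] at ht
    simp [← ht]
  · intro t ht
    simp only [Finset.mem_filter, Finset.mem_univ, true_and] at ht
    simp [← ht]
  · intro t ht
    simp only [Finset.mem_filter, Finset.mem_univ, true_and] at ht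
    simp [← ht]

theorem GG_mul {X : Type*} [Fintype X] (s : X × X → ℝ) (B : Set X) (a x z : X) :
    GG s B a x * s (x, z) = ∑ u : X → X, if u x = z ∧ PP B a x u then WW s B u else 0 := by
  unfold GG
  simp only [ite_and]
  rw [sum_update x z x, Finset.sum_mul]
  refine Finset.sum_congr rfl fun u _ => ?_
  rw [PP_update]
  by_cases h : u x = z
  · by_cases hp : PP B a x u
    · simp only [h, hp, if_true]
      rw [WW_insert s hp.1 u x, h, mul_comm]
    · simp [hp]
  · simp [h]

theorem GG_mul_sum {X : Type*} [Fintype X] (s : X × X → ℝ) (B : Set X) (a x : X) :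
    GG s B a x * ∑ z, s (x, z) = ∑ u : X → X, if PP B a x u then WW s B u else 0 := by
  rw [Finset.mul_sum]
  simp only [GG_mul]
  rw [Finset.sum_comm]
  refine Finset.sum_congr rfl fun u _ => ?_
  simp only [ite_and]
  simp

theorem green {X : Type*} [Fintype X] (s : X × X → ℝ) (B : Set X) (a y : X) (hy : y ∉ B) :
    ∑ x, GG s B a x * s (x, y) =
      GG s B a y * (∑ z, s (y, z)) - if y = a then TB s B else 0 := by
  have e : (if y = a then TB s B else 0) = ∑ u, if y = a ∧ TT B u then WW s B u else 0 := by
    unfold TB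
    by_cases h : y = a <;> simp [h]
  rw [e, GG_mul_sum]
  simp only [GG_mul]
  rw [Finset.sum_comm, ← Finset.sum_sub_distrib]
  refine Finset.sum_congr rfl fun u _ => ?_
  have := congrArg (· * WW s B u) (count (a := a) hy u)
  simpa only [Finset.sum_mul, sub_mul, ite_mul, one_mul, zero_mul] using this

theorem GG_mem {X : Type*} [Fintype X] (s : X × X → ℝ) (B : Set X) (a x : X) (hx : x ∈ B) :
    GG s B a x = 0 := by
  unfold GG
  refine Finset.sum_eq_zero fun t _ => ?_
  rw [if_neg]
  rintro ⟨_, h⟩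
  exact h.1 hx

theorem green_b {X : Type*} [Fintype X] (s : X × X → ℝ) (a b : X) (hab : a ≠ b) (y : X) :
    ∑ x, GG s {b} a x * s (x, y) =
      GG s {b} a y * (∑ z, s (y, z)) - (if y = a then TB s {b} else 0)
        + (if y = b then TB s {b} else 0) := by
  by_cases hy : y = b
  · subst hy
    have hsum : ∑ w, (∑ x, GG s {y} a x * s (x, w)) = ∑ w, GG s {y} a w * (∑ z, s (w, z)) := by
      rw [Finset.sum_comm]
      simp only [Finset.mul_sum]
    rw [← Finset.add_sum_erase _ _ (Finset.mem_univ y),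
      ← Finset.add_sum_erase _ (fun w => GG s {y} a w * (∑ z, s (w, z))) (Finset.mem_univ y)] at hsum
    have h2 : ∑ w ∈ Finset.univ.erase y, (∑ x, GG s {y} a x * s (x, w)) =
        ∑ w ∈ Finset.univ.erase y, (GG s {y} a w * (∑ z, s (w, z))
          - if w = a then TB s {y} else 0) := by
      refine Finset.sum_congr rfl fun w hw => green s {y} a w ?_
      simpa using hw
    rw [h2, Finset.sum_sub_distrib] at hsum
    have h3 : ∑ w ∈ Finset.univ.erase y, (if w = a then TB s {y} else 0) = TB s {y} := by
      rw [Finset.sum_ite_eq']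
      simp [hab]
    rw [h3] at hsum
    rw [if_neg hab.symm, if_pos rfl]
    linarith
  · rw [green s {b} a y (by simpa using hy), if_neg hy, add_zero]

theorem WW_congr_set {X : Type*} [Fintype X] (s : X × X → ℝ) {B C : Set X} (h : B = C)
    (t : X → X) : WW s B t = WW s C t := by rw [h]

theorem GG_empty {X : Type*} [Fintype X] (s : X × X → ℝ) (a x : X) :
    GG s ∅ a x = TB s {x} := by
  unfold GG TB
  refine Finset.sum_congr rfl fun t _ => ?_
  have : (t x = x ∧ PP ∅ a x t) ↔ TT {x} t := by
    unfold PP TT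
    simp only [insert_empty_eq]
    constructor
    · rintro ⟨h1, _, _, h2, _⟩
      exact ⟨by simpa using h1, h2⟩
    · rintro ⟨h1, h2⟩
      exact ⟨by simpa using h1, by simp, by simp, h2, h2 a⟩
  simp only [this, insert_empty_eq]

theorem TB_stat {X : Type*} [Fintype X] (s : X × X → ℝ) (y : X) :
    ∑ x, TB s {x} * s (x, y) = TB s {y} * (∑ z, s (y, z)) := by
  have := green s ∅ y y (by simp)
  simp only [GG_empty] at this
  have h0 : TB s (∅ : Set X) = 0 := by
    unfold TB
    refine Finset.sum_eq_zero fun t _ => ?_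
    rw [if_neg]
    rintro ⟨_, h⟩
    obtain ⟨n, hn⟩ := h y
    exact hn
  simpa [h0] using this

theorem GG_symm {X : Type*} [Fintype X] (s : X × X → ℝ) (a b : X) :
    GG s {b} a a = GG s {a} b b := by
  unfold GG
  refine Finset.sum_congr rfl fun t _ => ?_
  have aux : ∀ a b : X, (t a = a ∧ PP {b} a a t) → (t b = b ∧ PP {a} b b t) := by
    rintro a b ⟨h1, h2, h3, h4, h5⟩
    refine ⟨h3 b rfl, ?_, ?_, ?_, rch_self rfl⟩
    · simpa [eq_comm] using h2
    · simpa using h1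
    · rw [Set.pair_comm]; exact h4
  have : (t a = a ∧ PP {b} a a t) ↔ (t b = b ∧ PP {a} b b t) := ⟨aux a b, aux b a⟩
  simp only [this, Set.pair_comm a b]

theorem kernel_zero {X : Type*} [Fintype X] (s : X × X → ℝ) (hs : ∀ e, 0 < s e) (a : X)
    (φ : X → ℝ) (ha : φ a = 0) (h : ∀ y, ∑ x, φ x * s (x, y) = φ y * ∑ z, s (y, z)) (x : X) :
    φ x = 0 := by
  have h1 : ∀ y, |φ y| * ∑ z, s (y, z) ≤ ∑ x, |φ x| * s (x, y) := by
    intro y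
    have hpos : 0 ≤ ∑ z, s (y, z) := Finset.sum_nonneg fun z _ => (hs _).le
    rw [← abs_of_nonneg hpos, ← abs_mul, ← h y]
    refine (Finset.abs_sum_le_sum_abs _ _).trans (le_of_eq ?_)
    refine Finset.sum_congr rfl fun x _ => ?_
    rw [abs_mul, abs_of_pos (hs _)]
  have h2 : ∑ y, |φ y| * ∑ z, s (y, z) = ∑ y, ∑ x, |φ x| * s (x, y) := by
    rw [Finset.sum_comm]
    simp only [Finset.mul_sum]
  have h3 := (Finset.sum_eq_sum_iff_of_le (fun y _ => h1 y)).1 h2 a (Finset.mem_univ _)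
  rw [ha, abs_zero, zero_mul] at h3
  have h4 := (Finset.sum_eq_zero_iff_of_nonneg
    (fun x _ => mul_nonneg (abs_nonneg _) (hs _).le)).1 h3.symm x (Finset.mem_univ _)
  rcases mul_eq_zero.1 h4 with h5 | h5
  · exact abs_eq_zero.1 h5
  · exact absurd h5 (hs _).ne'

theorem main_pos {X : Type*} [Fintype X] (s : X × X → ℝ) (hs : ∀ e, 0 < s e)
    (a b : X) (hab : a ≠ b) (x : X) :
    GG s {b} a a * TB s {x} = TB s {a} * GG s {b} a x + TB s {b} * GG s {a} b x := by
  have := kernel_zero s hs a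
    (fun x => GG s {b} a a * TB s {x} - (TB s {a} * GG s {b} a x + TB s {b} * GG s {a} b x))
    ?_ ?_ x
  · exact sub_eq_zero.1 this
  · simp only [GG_mem s {a} b a rfl]
    ring
  · intro y
    have e : ∀ x, (GG s {b} a a * TB s {x} -
        (TB s {a} * GG s {b} a x + TB s {b} * GG s {a} b x)) * s (x, y) =
        GG s {b} a a * (TB s {x} * s (x, y)) - (TB s {a} * (GG s {b} a x * s (x, y))
          + TB s {b} * (GG s {a} b x * s (x, y))) := by intro x; ring
    simp only [e, Finset.sum_sub_distrib, Finset.sum_add_distrib, ← Finset.mul_sum]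
    rw [TB_stat, green_b s a b hab, green_b s b a hab.symm]
    by_cases h1 : y = a <;> by_cases h2 : y = b <;> simp only [h1, h2, if_true, if_false] <;>
      ring_nf
    all_goals simp [hab, hab.symm]

theorem WW_cont {X : Type*} [Fintype X] (s : X × X → ℝ) (B : Set X) (t : X → X) :
    Continuous fun ε : ℝ => WW (fun e => s e + ε) B t := by
  unfold WW
  fun_prop

theorem GG_cont {X : Type*} [Fintype X] (s : X × X → ℝ) (B : Set X) (a x : X) :
    Continuous fun ε : ℝ => GG (fun e => s e + ε) B a x := by
  unfold GG
  refine continuous_finsetSum _ fun t _ => ?_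
  split_ifs
  · exact WW_cont _ _ _
  · exact continuous_const

theorem TB_cont {X : Type*} [Fintype X] (s : X × X → ℝ) (B : Set X) :
    Continuous fun ε : ℝ => TB (fun e => s e + ε) B := by
  unfold TB
  refine continuous_finsetSum _ fun t _ => ?_
  split_ifs
  · exact WW_cont _ _ _
  · exact continuous_const

theorem main_nonneg {X : Type*} [Fintype X] (s : X × X → ℝ) (hs : ∀ e, 0 ≤ s e)
    (a b : X) (hab : a ≠ b) (x : X) :
    GG s {b} a a * TB s {x} = TB s {a} * GG s {b} a x + TB s {b} * GG s {a} b x := by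
  have c1 : Continuous fun ε : ℝ =>
      GG (fun e => s e + ε) {b} a a * TB (fun e => s e + ε) {x} :=
    (GG_cont s {b} a a).mul (TB_cont s {x})
  have c2 : Continuous fun ε : ℝ =>
      TB (fun e => s e + ε) {a} * GG (fun e => s e + ε) {b} a x
        + TB (fun e => s e + ε) {b} * GG (fun e => s e + ε) {a} b x :=
    ((TB_cont s {a}).mul (GG_cont s {b} a x)).add ((TB_cont s {b}).mul (GG_cont s {a} b x))
  have t1 := (c1.tendsto 0).mono_left (nhdsWithin_le_nhds (s := Set.Ioi 0))
  have t2 := (c2.tendsto 0).mono_left (nhdsWithin_le_nhds (s := Set.Ioi 0))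
  have := tendsto_nhds_unique (t1.congr' ?_) t2
  · simpa using this
  · filter_upwards [self_mem_nhdsWithin] with ε hε
    exact main_pos _ (fun e => add_pos_of_nonneg_of_pos (hs e) hε) a b hab x

/-- Rates with the pinned edge deleted. -/
def del {X : Type*} (r : X × X → ℝ) (a b : X) : X × X → ℝ :=
  fun e => if e = (a, b) ∨ e = (b, a) then 0 else r e

theorem isRootedTree_iff {X : Type*} (x : X) (t : X → X) : IsRootedTree x t ↔ TT {x} t := by
  unfold IsRootedTree TT Rch
  simp

theorem tau_del {X : Type*} [Fintype X] (r : X × X → ℝ) (a b x : X) :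
    tau r x {(a, b), (b, a)} ∅ = TB (del r a b) {x} := by
  unfold tau TB
  refine Finset.sum_congr rfl fun t _ => ?_
  rw [isRootedTree_iff]
  by_cases ht : TT {x} t
  · by_cases hA : treeEdges x t ∩ {(a, b), (b, a)} = ∅
    · rw [if_pos ⟨ht, hA, Set.empty_subset _⟩, if_pos ht]
      unfold treeWeight WW
      simp only [Set.mem_singleton_iff]
      refine Finset.prod_congr rfl fun y hy => ?_
      unfold del
      rw [if_neg]
      intro h
      have : (y, t y) ∈ treeEdges x t ∩ {(a, b), (b, a)} :=
        ⟨⟨by simpa using hy, rfl⟩, h⟩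
      rw [hA] at this
      exact this
    · rw [if_neg (fun h => hA h.2.1), if_pos ht]
      obtain ⟨⟨y, z⟩, ⟨hy, hz⟩, he⟩ := Set.nonempty_iff_ne_empty.2 hA
      simp only at hy hz
      subst hz
      unfold WW
      symm
      apply Finset.prod_eq_zero (i := y)
      · simpa using hy
      · unfold del
        exact if_pos he
  · rw [if_neg (fun h => ht h.1), if_neg ht]

theorem tau_con {X : Type*} [Fintype X] (r : X × X → ℝ) (a b x : X) (hab : a ≠ b) :
    tau r x {(a, b)} {(b, a)} = r (b, a) * GG (del r a b) {b} a x := by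
  by_cases hxb : x = b
  · subst hxb
    rw [GG_mem _ _ _ _ (Set.mem_singleton _), mul_zero]
    unfold tau
    refine Finset.sum_eq_zero fun t _ => ?_
    rw [if_neg]
    rintro ⟨_, _, h⟩
    exact (h rfl).1 rfl
  have e1 : tau r x {(a, b)} {(b, a)} =
      ∑ t : X → X, if t b = a then (if TT {x} t then WW r {x} t else 0) else 0 := by
    unfold tau
    refine Finset.sum_congr rfl fun t _ => ?_
    rw [isRootedTree_iff, ← ite_and]
    have : (TT {x} t ∧ treeEdges x t ∩ {(a, b)} = ∅ ∧ {(b, a)} ⊆ treeEdges x t) ↔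
        (t b = a ∧ TT {x} t) := by
      constructor
      · rintro ⟨h1, _, h2⟩
        exact ⟨(h2 rfl).2.symm, h1⟩
      · rintro ⟨h1, h2⟩
        refine ⟨h2, ?_, ?_⟩
        · rw [Set.eq_empty_iff_forall_notMem]
          rintro p ⟨⟨h3, h4⟩, h5⟩
          rw [Set.mem_singleton_iff] at h5
          subst h5
          simp only at h3 h4
          refine not_fixed_rch (u := t) (B := {x}) h2.1 (x := b) (y := b) (fun h => hxb h.symm)
            (rch_self rfl) ?_ (h2.2 b)
          rw [h1]
          exact ⟨1, by simp [h4]⟩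
        · rintro p hp
          rw [Set.mem_singleton_iff] at hp
          subst hp
          exact ⟨fun h => hxb h.symm, h1.symm⟩
    simp only [this]
    rfl
  rw [e1, sum_update b b a]
  unfold GG
  rw [Finset.mul_sum]
  refine Finset.sum_congr rfl fun u _ => ?_
  rw [← ite_and]
  have hiff : (u b = b ∧ TT {x} (Function.update u b a)) ↔ (u x = x ∧ PP {b} a x u) := by
    constructor
    · rintro ⟨h1, h2, h3⟩
      have hx : u x = x := by
        have := h2 x rfl
        rwa [Function.update_of_ne hxb] at this
      have huu : Function.update (Function.update u b a) b b = u := by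
        rw [Function.update_idem]
        exact Function.update_eq_self_iff.2 h1.symm
      refine ⟨hx, hxb, by simpa using h1, ?_, ?_⟩
      · intro v
        have := rch_update (u := Function.update u b a) (C := {x, b}) (y := b) (by simp) b
          (rch_mono (h3 v) fun w hw => rch_self (Or.inl hw))
        rwa [huu] at this
      · have := rch_update (u := Function.update u b a) (C := {x, b}) (y := b) (by simp) b
          (rch_mono (h3 a) fun w hw => rch_self (Or.inl hw))
        rw [huu] at this
        obtain ⟨n, hn⟩ := this
        rcases hn with hn | hn
        · exact ⟨n, hn⟩
        · exfalso
          have hr : Rch (Function.update u b a) {b} a := rch_update (Set.mem_singleton _) a ⟨n, hn⟩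
          refine not_fixed_rch (u := Function.update u b a) (B := {x}) h2 (x := b) (y := b)
            (fun h => hxb h.symm) (rch_self rfl) ?_ (h3 b)
          simpa using hr
    · rintro ⟨h1, _, h2, h3, h4⟩
      have hb := h2 b rfl
      have hx : Function.update u b a x = x := by rwa [Function.update_of_ne hxb]
      have ha : Rch (Function.update u b a) {x} a := by
        obtain ⟨n, hn⟩ := rch_update (C := {x, b}) (y := b) (by simp) a
          (rch_mono h4 fun w hw => rch_self (Or.inl hw))
        rcases hn with hn | hn
        · exact ⟨n, hn⟩
        · exfalso
          have hr := rch_update (y := b) (C := {b}) (Set.mem_singleton _) b ⟨n, hn⟩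
          have huu : Function.update (Function.update u b a) b b = u := by
            rw [Function.update_idem]
            exact Function.update_eq_self_iff.2 hb.symm
          rw [huu] at hr
          exact hxb (fixed_unique h1 hb h4 hr)
      refine ⟨hb, by simpa using hx, ?_⟩
      intro v
      refine rch_mono (rch_update (y := b) (by simp) a (h3 v)) ?_
      rintro w (rfl | hw)
      · exact rch_self rfl
      · rw [Set.mem_singleton_iff] at hw
        subst hw
        apply rch_step
        simpa using ha
  by_cases hc : u x = x ∧ PP {b} a x u
  · rw [if_pos (hiff.2 hc), if_pos hc]
    rw [WW_insert r (x := b) (by simpa using fun h => hxb h.symm) _ b]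
    simp only [Function.update_self, Function.update_idem]
    have hb : u b = b := hc.2.2.1 b rfl
    congr 1
    have : Function.update u b b = u := Function.update_eq_self_iff.2 hb.symm
    rw [this, Set.pair_comm b x]
    unfold WW
    refine Finset.prod_congr rfl fun y hy => ?_
    unfold del
    rw [if_neg]
    simp only [Finset.mem_filter, Finset.mem_univ, true_and, Set.mem_insert_iff,
      Set.mem_singleton_iff, not_or] at hy
    rintro (h | h)
    · simp only [Prod.mk.injEq] at h
      obtain ⟨rfl, h⟩ := h
      have h4 := hc.2.2.2.2
      rcases rch_cases h4 with h5 | h5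
      · exact hy.1 h5
      · rw [h] at h5
        exact hxb (rch_fixed hb h5).symm
    · simp only [Prod.mk.injEq] at h
      exact hy.2 h.1
  · rw [if_neg (fun h => hc (hiff.1 h)), if_neg hc, mul_zero]

theorem tau_root {X : Type*} [Fintype X] (r : X × X → ℝ) (a b : X) :
    tau r b ∅ {(a, b)} = tau r b {(b, a)} {(a, b)} := by
  unfold tau
  refine Finset.sum_congr rfl fun t _ => ?_
  have : treeEdges b t ∩ {(b, a)} = ∅ := by
    rw [Set.eq_empty_iff_forall_notMem]
    rintro p ⟨⟨h3, h4⟩, h5⟩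
    rw [Set.mem_singleton_iff] at h5
    subst h5
    exact h3 rfl
  simp only [this, Set.inter_empty]

theorem del_comm {X : Type*} (r : X × X → ℝ) (a b : X) : del r a b = del r b a := by
  unfold del
  funext e
  simp only [or_comm]

theorem del_nonneg {X : Type*} (r : X × X → ℝ) (hr : ∀ e, 0 ≤ r e) (a b : X) (e : X × X) :
    0 ≤ del r a b e := by
  unfold del
  split_ifs
  · exact le_rfl
  · exact hr e

theorem stmt_6 {X : Type*} [Fintype X] (r : X × X → ℝ) (hr : ∀ e, 0 ≤ r e)
    (a b : X) (hab : a ≠ b) (hpab : 0 < r (a, b)) (hpba : 0 < r (b, a)) (x : X) :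
    r (b, a) * tau r b ∅ {(a, b)} * tau r x {(a, b), (b, a)} ∅ =
      r (a, b) * tau r a {(a, b), (b, a)} ∅ * tau r x {(a, b)} {(b, a)} +
      r (b, a) * tau r b {(a, b), (b, a)} ∅ * tau r x {(b, a)} {(a, b)} := by
  rw [tau_root, tau_con r b a b hab.symm, tau_con r b a x hab.symm, tau_con r a b x hab,
    tau_del, tau_del, tau_del, del_comm r b a, ← GG_symm]
  have := main_nonneg (del r a b) (del_nonneg r hr a b) a b hab x
  linear_combination r (a, b) * r (b, a) * this
end
end

section
/- Coplanarity of spanning-tree vectors (Theorem 3): assume the graph is irreducible. For each x ∈ X set v_x := (τ_x^{∖{+1,−1}}, τ_x^{∖{−1}∥{+1}}, τ_x^{∖{+1}∥{−1}}) ∈ ℝ³. Then the vector σ := (−r(b,a)·τ_b^{∥{+1}}, r(b,a)·τ_b^{∖{+1,−1}}, r(a,b)·τ_a^{∖{+1,−1}}) is nonzero and satisfies σ · v_x = 0 for every x ∈ X; consequently the ℝ-linear span of {v_x : x ∈ X} has dimension at most 2 (all the vectors v_x are coplanar). -/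
open scoped Classical

noncomputable section

/-- The spanning-tree 3-vector `v_x = (τ_x^{∖{+1,−1}}, τ_x^{∖{−1}∥{+1}}, τ_x^{∖{+1}∥{−1}})`. -/
def tauVec {X : Type*} [Fintype X] (r : X × X → ℝ) (a b : X) (x : X) : Fin 3 → ℝ :=
  ![tau r x {(a, b), (b, a)} ∅, tau r x {(b, a)} {(a, b)}, tau r x {(a, b)} {(b, a)}]

/-- The normal vector `σ = (−r(b,a) τ_b^{∥{+1}}, r(b,a) τ_b^{∖{+1,−1}}, r(a,b) τ_a^{∖{+1,−1}})`. -/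
def sigmaVec {X : Type*} [Fintype X] (r : X × X → ℝ) (a b : X) : Fin 3 → ℝ :=
  ![-(r (b, a) * tau r b ∅ {(a, b)}),
    r (b, a) * tau r b {(a, b), (b, a)} ∅,
    r (a, b) * tau r a {(a, b), (b, a)} ∅]

/-- Unconditioned-by-edges variant: sum over rooted trees satisfying a predicate. -/
def treeSum {X : Type*} [Fintype X] (r : X × X → ℝ) (x : X) (p : (X → X) → Prop) : ℝ :=
  ∑ t : X → X, if IsRootedTree x t ∧ p t then treeWeight r x t else 0

lemma reach_update {X : Type*} (f : X → X) (y v : X) :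
    ∀ (n : ℕ) (z : X), f^[n] z = y → ∃ m, (Function.update f y v)^[m] z = y := by
  intro n
  induction n with
  | zero => intro z h; exact ⟨0, h⟩
  | succ n ih =>
    intro z h
    by_cases hz : z = y
    · exact ⟨0, hz⟩
    · obtain ⟨m, hm⟩ := ih (f z) h
      refine ⟨m + 1, ?_⟩
      rw [Function.iterate_succ_apply, Function.update_of_ne hz]
      exact hm

lemma mem_edges_iff {X : Type*} {x : X} {t : X → X} (ht : IsRootedTree x t) {a b : X}
    (hab : a ≠ b) : (a, b) ∈ treeEdges x t ↔ t a = b := by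
  unfold treeEdges
  constructor
  · rintro ⟨_, h⟩; exact h.symm
  · intro h
    refine ⟨?_, h.symm⟩
    rintro rfl
    exact hab (ht.1.symm.trans h)

lemma tau_eq {X : Type*} [Fintype X] (r : X × X → ℝ) (x : X) (A B : Set (X × X))
    (p : (X → X) → Prop)
    (h : ∀ t, IsRootedTree x t → ((treeEdges x t ∩ A = ∅ ∧ B ⊆ treeEdges x t) ↔ p t)) :
    tau r x A B = treeSum r x p := by
  unfold tau treeSum
  refine Finset.sum_congr rfl fun t _ => ?_
  refine if_congr ?_ rfl rfl
  constructor
  · rintro ⟨h1, h2⟩; exact ⟨h1, (h t h1).1 h2⟩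
  · rintro ⟨h1, h2⟩; exact ⟨h1, (h t h1).2 h2⟩

lemma weight_mul {X : Type*} [Fintype X] (r : X × X → ℝ) (y v : X) (t : X → X) :
    r (y, v) * treeWeight r y t = ∏ z, r (z, Function.update t y v z) := by
  unfold treeWeight
  rw [← Finset.mul_prod_erase Finset.univ _ (Finset.mem_univ y)]
  rw [Function.update_self]
  congr 1
  rw [Finset.filter_ne']
  refine Finset.prod_congr rfl fun z hz => ?_
  rw [Function.update_of_ne (Finset.ne_of_mem_erase hz)]

lemma sideA {X : Type*} [Fintype X] (r : X × X → ℝ) (x : X) (p : (X → X) → Prop)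
    (h1 : ∀ f, p (Function.update f x x) ↔ p f) :
    (∑ z, r (x, z)) * treeSum r x p =
      ∑ f : X → X with ((∀ z, ∃ n : ℕ, f^[n] z = x) ∧ p f), ∏ z, r (z, f z) := by
  unfold treeSum
  rw [← Finset.sum_filter, Finset.sum_mul_sum, ← Finset.sum_product']
  refine Finset.sum_nbij' (fun q => Function.update q.2 x q.1)
    (fun f => (f x, Function.update f x x)) ?_ ?_ ?_ ?_ ?_
  · rintro ⟨z, t⟩ h
    simp only [Finset.mem_product, Finset.mem_filter, Finset.mem_univ, true_and] at h ⊢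
    refine ⟨fun w => ?_, ?_⟩
    · obtain ⟨n, hn⟩ := h.1.2 w
      exact reach_update t x z n w hn
    · rw [← h1, Function.update_idem, h1]; exact h.2
  · intro f h
    simp only [Finset.mem_product, Finset.mem_filter, Finset.mem_univ, true_and] at h ⊢
    refine ⟨⟨Function.update_self .., fun w => ?_⟩, (h1 f).2 h.2⟩
    obtain ⟨n, hn⟩ := h.1 w
    exact reach_update f x x n w hn
  · rintro ⟨z, t⟩ h
    simp only [Finset.mem_product, Finset.mem_filter, Finset.mem_univ, true_and] at h ⊢
    rw [Function.update_self, Function.update_idem]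
    congr 1
    rw [Function.update_eq_self_iff]
    exact h.1.1.symm
  · intro f h
    simp
  · rintro ⟨z, t⟩ h
    exact weight_mul r x z t

lemma periodic_aux {X : Type*} {x y : X} {t : X → X} (ht : IsRootedTree y t) :
    y ∈ Function.periodicPts (Function.update t y x) := by
  obtain ⟨n, hn⟩ := ht.2 x
  obtain ⟨m, hm⟩ := reach_update t y x n x hn
  refine ⟨m + 1, Nat.succ_pos _, ?_⟩
  unfold Function.IsPeriodicPt Function.IsFixedPt
  rw [Function.iterate_succ_apply, Function.update_self, hm]

lemma sideB {X : Type*} [Fintype X] (r : X × X → ℝ) (x : X) (p : (X → X) → Prop)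
    (h2 : ∀ f y, f y = x → (p (Function.update f y y) ↔ p f)) :
    ∑ y, r (y, x) * treeSum r y p =
      ∑ f : X → X with ((∀ z, ∃ n : ℕ, f^[n] z = x) ∧ p f), ∏ z, r (z, f z) := by
  unfold treeSum
  have key : ∀ (y : X) (t : X → X), IsRootedTree y t →
      Function.update (Function.update t y x) y y = t := by
    intro y t ht
    rw [Function.update_idem, Function.update_eq_self_iff]
    exact ht.1.symm
  simp_rw [Finset.mul_sum, mul_ite, mul_zero]
  rw [← Finset.sum_product', ← Finset.sum_filter]
  refine Finset.sum_bij (fun q _ => Function.update q.2 q.1 x) ?_ ?_ ?_ ?_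
  · rintro ⟨y, t⟩ h
    simp only [Finset.mem_product, Finset.mem_filter, Finset.mem_univ, true_and] at h ⊢
    refine ⟨fun w => ?_, ?_⟩
    · obtain ⟨n, hn⟩ := h.1.2 w
      obtain ⟨m, hm⟩ := reach_update t y x n w hn
      refine ⟨m + 1, ?_⟩
      rw [Function.iterate_succ_apply', hm, Function.update_self]
    · rw [← h2 _ y (Function.update_self ..), key y t h.1]; exact h.2
  · rintro ⟨y, t⟩ h ⟨y', t'⟩ h' e
    simp only [Finset.mem_product, Finset.mem_filter, Finset.mem_univ, true_and] at h h' e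
    have e1 : y = y' := by
      have k1 := periodic_aux (x := x) h.1
      have k2 := periodic_aux (x := x) h'.1
      rw [← e] at k2
      refine (Function.bijOn_periodicPts (Function.update t y x)).injOn k1 k2 ?_
      rw [Function.update_self, e, Function.update_self]
    subst e1
    have := key y t h.1
    rw [e, key y t' h'.1] at this
    rw [this]
  · intro f h
    simp only [Finset.mem_filter, Finset.mem_univ, true_and] at h
    have hx : x ∈ Function.periodicPts f := by
      obtain ⟨n, hn⟩ := h.1 (f x)
      exact ⟨n + 1, Nat.succ_pos _, hn⟩
    obtain ⟨y, hy, hyx⟩ := (Function.bijOn_periodicPts f).surjOn hx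
    obtain ⟨n, hn, hn'⟩ := hy
    refine ⟨(y, Function.update f y y), ?_, ?_⟩
    · simp only [Finset.mem_product, Finset.mem_filter, Finset.mem_univ, true_and]
      refine ⟨⟨Function.update_self .., fun w => ?_⟩, (h2 f y hyx).2 h.2⟩
      obtain ⟨m, hm⟩ := h.1 w
      obtain ⟨k, rfl⟩ : ∃ k, n = k + 1 := ⟨n - 1, by omega⟩
      refine reach_update f y y (k + m) w ?_
      rw [Function.iterate_add_apply, hm, ← hyx, ← Function.iterate_succ_apply]
      exact hn'
    · show Function.update (Function.update f y y) y x = f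
      rw [Function.update_idem, Function.update_eq_self_iff]
      exact hyx.symm
  · rintro ⟨y, t⟩ h
    exact weight_mul r y x t

/-- Conditioned Markov chain tree theorem. -/
lemma mctt {X : Type*} [Fintype X] (r : X × X → ℝ) (x : X) (p : (X → X) → Prop)
    (h1 : ∀ f, p (Function.update f x x) ↔ p f)
    (h2 : ∀ f y, f y = x → (p (Function.update f y y) ↔ p f)) :
    ∑ y, r (y, x) * treeSum r y p = (∑ z, r (x, z)) * treeSum r x p := by
  rw [sideA r x p h1, sideB r x p h2]

lemma edge_update {X : Type*} {a b x : X} (hab : a ≠ b) (hb : x ≠ b)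
    (f : X → X) (y : X) (h : f y = x) : (Function.update f y y a = b) ↔ f a = b := by
  by_cases hy : a = y
  · subst hy
    rw [Function.update_self]
    constructor
    · intro h'; exact absurd h' hab
    · intro h'; exact absurd (h.symm.trans h') hb
  · rw [Function.update_of_ne hy]

lemma edge_update' {X : Type*} {a b x : X} (ha : x ≠ a)
    (f : X → X) : (Function.update f x x a = b) ↔ f a = b := by
  rw [Function.update_of_ne ha.symm]

/-- Dirichlet uniqueness. -/
lemma uniq {X : Type*} [Fintype X] (r : X × X → ℝ) (hr : ∀ e, 0 ≤ r e)
    (hirr : Irreducible' r) (a b : X) (g : X → ℝ) (ha : g a = 0) (hb : g b = 0)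
    (hg : ∀ x, x ≠ a → x ≠ b → ∑ y, r (y, x) * g y = (∑ z, r (x, z)) * g x) :
    ∀ x, g x = 0 := by
  have hle : ∀ x, (∑ z, r (x, z)) * |g x| ≤ ∑ y, r (y, x) * |g y| := by
    intro x
    have hnn : 0 ≤ ∑ y, r (y, x) * |g y| :=
      Finset.sum_nonneg fun y _ => mul_nonneg (hr _) (abs_nonneg _)
    by_cases hxa : x = a
    · rw [hxa] at hnn ⊢; simpa [ha] using hnn
    by_cases hxb : x = b
    · rw [hxb] at hnn ⊢; simpa [hb] using hnn
    have hR : 0 ≤ ∑ z, r (x, z) := Finset.sum_nonneg fun z _ => hr _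
    rw [← abs_of_nonneg hR, ← abs_mul, ← hg x hxa hxb]
    refine (Finset.abs_sum_le_sum_abs _ _).trans (le_of_eq ?_)
    refine Finset.sum_congr rfl fun y _ => ?_
    rw [abs_mul, abs_of_nonneg (hr _)]
  have hsum : ∑ x, (∑ z, r (x, z)) * |g x| = ∑ x, ∑ y, r (y, x) * |g y| := by
    rw [Finset.sum_comm]
    simp_rw [Finset.sum_mul]
  have heq : ∀ x, (∑ z, r (x, z)) * |g x| = ∑ y, r (y, x) * |g y| := by
    intro x
    exact (Finset.sum_eq_sum_iff_of_le (fun i _ => hle i)).1 hsum x (Finset.mem_univ x)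
  have hstep : ∀ x y, g x = 0 → 0 < r (y, x) → g y = 0 := by
    intro x y hx hyx
    have h := heq x
    rw [hx, abs_zero, mul_zero] at h
    have h' := (Finset.sum_eq_zero_iff_of_nonneg
      (fun y _ => mul_nonneg (hr (y, x)) (abs_nonneg (g y)))).1 h.symm y (Finset.mem_univ y)
    rcases mul_eq_zero.1 h' with h'' | h''
    · exact absurd h'' hyx.ne'
    · exact abs_eq_zero.1 h''
  intro x
  by_cases hxa : x = a
  · rw [hxa, ha]
  obtain ⟨n, f, h0, hn, hf⟩ := hirr x a hxa
  have : ∀ k, k ≤ n → g (f (n - k)) = 0 := by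
    intro k
    induction k with
    | zero => intro _; rw [Nat.sub_zero, hn, ha]
    | succ k ih =>
      intro hk
      refine hstep _ _ (ih (by omega)) ?_
      have := hf (n - (k + 1)) (by omega)
      rwa [show n - (k + 1) + 1 = n - k by omega] at this
  have := this n le_rfl
  rwa [Nat.sub_self, h0] at this

/-- Existence of a positive tree rooted at `b` through the edge `(a,b)`. -/
lemma exists_tree {X : Type*} (r : X × X → ℝ)
    (hirr : Irreducible' r) (a b : X) (hab : a ≠ b) (hpab : 0 < r (a, b)) :
    ∃ t : X → X, IsRootedTree b t ∧ t a = b ∧ ∀ y, y ≠ b → 0 < r (y, t y) := by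
  let P : X → ℕ → Prop := fun y n =>
    ∃ f : ℕ → X, f 0 = y ∧ f n = b ∧ ∀ i < n, 0 < r (f i, f (i + 1))
  have hP : ∀ y, ∃ n, P y n := by
    intro y
    by_cases hy : y = b
    · exact ⟨0, fun _ => b, hy.symm, rfl, by simp⟩
    · exact hirr y b hy
  let d : X → ℕ := fun y => Nat.find (hP y)
  have hd0 : ∀ y, d y = 0 → y = b := by
    intro y h
    obtain ⟨f, h0, h1, _⟩ := Nat.find_spec (hP y)
    have h' : Nat.find (hP y) = 0 := h
    rw [h', h0] at h1
    exact h1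
  have hdb : d b = 0 := by
    have : P b 0 := ⟨fun _ => b, rfl, rfl, by simp⟩
    exact Nat.le_zero.1 (Nat.find_min' (hP b) this)
  have hnext : ∀ y, ∃ z, (y = b → z = b) ∧ (y = a → z = b) ∧
      (y ≠ b → 0 < r (y, z) ∧ d z < d y) := by
    intro y
    by_cases hy : y = b
    · exact ⟨b, by simp [hy]⟩
    have hpos : 0 < d y := Nat.pos_of_ne_zero fun h => hy (hd0 y h)
    by_cases hya : y = a
    · refine ⟨b, by simp, by simp, fun _ => ⟨?_, ?_⟩⟩
      · rw [hya]; exact hpab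
      · rw [hdb]; exact hpos
    obtain ⟨f, h0, h1, h2⟩ := Nat.find_spec (hP y)
    refine ⟨f 1, fun h => absurd h hy, fun h => absurd h hya, fun _ => ⟨?_, ?_⟩⟩
    · have := h2 0 hpos
      rwa [h0] at this
    · have hlt : P (f 1) (d y - 1) := by
        refine ⟨fun i => f (i + 1), rfl, ?_, fun i hi => h2 (i + 1) ?_⟩
        · show f (d y - 1 + 1) = b
          rw [Nat.sub_add_cancel hpos]; exact h1
        · show i + 1 < d y
          omega
      have := Nat.find_min' (hP (f 1)) hlt
      change d (f 1) ≤ _ at this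
      omega
  choose t ht1 ht2 ht3 using hnext
  refine ⟨t, ⟨ht1 b rfl, ?_⟩, ht2 a rfl, fun y hy => (ht3 y hy).1⟩
  have : ∀ k y, d y ≤ k → ∃ n : ℕ, t^[n] y = b := by
    intro k
    induction k with
    | zero => intro y h; exact ⟨0, hd0 y (Nat.le_zero.1 h)⟩
    | succ k ih =>
      intro y h
      by_cases hy : y = b
      · exact ⟨0, hy⟩
      obtain ⟨n, hn⟩ := ih (t y) (by have := (ht3 y hy).2; omega)
      exact ⟨n + 1, hn⟩
  exact fun y => this _ y le_rfl

lemma treeSum_pos {X : Type*} [Fintype X] (r : X × X → ℝ) (hr : ∀ e, 0 ≤ r e)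
    (x : X) (p : (X → X) → Prop) (t : X → X) (ht : IsRootedTree x t) (hp : p t)
    (hpos : ∀ y, y ≠ x → 0 < r (y, t y)) : 0 < treeSum r x p := by
  unfold treeSum
  refine Finset.sum_pos' (fun s _ => ?_) ⟨t, Finset.mem_univ t, ?_⟩
  · split_ifs
    · exact Finset.prod_nonneg fun y _ => hr _
    · exact le_rfl
  · rw [if_pos ⟨ht, hp⟩]
    exact Finset.prod_pos fun y hy => hpos y (Finset.mem_filter.1 hy).2

/-- Swap the root along the pinned edge. -/
lemma swap_tree {X : Type*} {a b : X} (hab : a ≠ b) {t : X → X} (ht : IsRootedTree b t) :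
    IsRootedTree a (Function.update (Function.update t a a) b a) := by
  refine ⟨by rw [Function.update_of_ne hab, Function.update_self], ?_⟩
  have : ∀ n z, t^[n] z = b →
      ∃ m : ℕ, (Function.update (Function.update t a a) b a)^[m] z = a := by
    intro n
    induction n with
    | zero => intro z h; exact ⟨1, by
        have h : z = b := h
        rw [h, Function.iterate_one, Function.update_self]⟩
    | succ n ih =>
      intro z h
      by_cases hza : z = a
      · exact ⟨0, hza⟩
      by_cases hzb : z = b
      · exact ⟨1, by rw [hzb, Function.iterate_one, Function.update_self]⟩
      obtain ⟨m, hm⟩ := ih (t z) h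
      refine ⟨m + 1, ?_⟩
      rw [Function.iterate_succ_apply, Function.update_of_ne hzb, Function.update_of_ne hza]
      exact hm
  intro y
  obtain ⟨n, hn⟩ := ht.2 y
  exact this n y hn

lemma swap_inv {X : Type*} {a b : X} (hab : a ≠ b) {t : X → X} (hb : t b = b) (ha : t a = b) :
    Function.update (Function.update (Function.update (Function.update t a a) b a) b b) a b
      = t := by
  funext z
  by_cases hza : z = a
  · rw [hza, Function.update_self, ha]
  by_cases hzb : z = b
  · rw [hzb, Function.update_of_ne hab.symm, Function.update_self, hb]
  · simp [Function.update_of_ne hza, Function.update_of_ne hzb]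

lemma swap_sum {X : Type*} [Fintype X] (r : X × X → ℝ) (a b : X) (hab : a ≠ b) :
    r (b, a) * treeSum r b (fun t => t a = b) = r (a, b) * treeSum r a (fun t => t b = a) := by
  unfold treeSum
  rw [← Finset.sum_filter, ← Finset.sum_filter, Finset.mul_sum, Finset.mul_sum]
  refine Finset.sum_nbij' (fun t => Function.update (Function.update t a a) b a)
    (fun t => Function.update (Function.update t b b) a b) ?_ ?_ ?_ ?_ ?_
  · intro t h
    simp only [Finset.mem_filter, Finset.mem_univ, true_and] at h ⊢
    exact ⟨swap_tree hab h.1, Function.update_self ..⟩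
  · intro t h
    simp only [Finset.mem_filter, Finset.mem_univ, true_and] at h ⊢
    exact ⟨swap_tree hab.symm h.1, Function.update_self ..⟩
  · intro t h
    simp only [Finset.mem_filter, Finset.mem_univ, true_and] at h ⊢
    exact swap_inv hab h.1.1 h.2
  · intro t h
    simp only [Finset.mem_filter, Finset.mem_univ, true_and] at h ⊢
    exact swap_inv hab.symm h.1.1 h.2
  · intro t h
    simp only [Finset.mem_filter, Finset.mem_univ, true_and] at h
    rw [weight_mul, weight_mul]
    refine Finset.prod_congr rfl fun z _ => ?_
    congr 2
    by_cases hza : z = a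
    · rw [hza, Function.update_of_ne hab, Function.update_self, h.2]
    by_cases hzb : z = b
    · rw [hzb, Function.update_self, Function.update_of_ne hab.symm, Function.update_self]
    · simp [Function.update_of_ne hza, Function.update_of_ne hzb]

lemma no_two_cycle {X : Type*} {x a b : X} (hab : a ≠ b) {t : X → X} (ht : IsRootedTree x t)
    (h1 : t a = b) (h2 : t b = a) : False := by
  have h : ∀ n : ℕ, t^[n] a = a ∨ t^[n] a = b := by
    intro n
    induction n with
    | zero => exact Or.inl rfl
    | succ n ih =>
      rw [Function.iterate_succ_apply']
      rcases ih with h | h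
      · right; rw [h, h1]
      · left; rw [h, h2]
  obtain ⟨n, hn⟩ := ht.2 a
  have hx := ht.1
  rcases h n with h' | h'
  · have : x = a := hn.symm.trans h'
    rw [this, h1] at hx; exact hab hx.symm
  · have : x = b := hn.symm.trans h'
    rw [this, h2] at hx; exact hab hx

theorem stmt_8 {X : Type*} [Fintype X] (r : X × X → ℝ) (hr : ∀ e, 0 ≤ r e)
    (hirr : Irreducible' r)
    (a b : X) (hab : a ≠ b) (hpab : 0 < r (a, b)) (hpba : 0 < r (b, a)) :
    sigmaVec r a b ≠ 0 ∧
    (∀ x : X, ∑ i, sigmaVec r a b i * tauVec r a b x i = 0) ∧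
    Module.finrank ℝ (Submodule.span ℝ (Set.range (tauVec r a b))) ≤ 2 := by
  have hT : ∀ x, tau r x {(a, b), (b, a)} ∅ = treeSum r x (fun t => t a ≠ b ∧ t b ≠ a) := by
    intro x
    refine tau_eq r x _ _ _ fun t ht => ?_
    rw [Ne, Ne, ← mem_edges_iff ht hab, ← mem_edges_iff ht hab.symm,
      ← Set.disjoint_iff_inter_eq_empty, Set.disjoint_insert_right, Set.disjoint_singleton_right]
    simp
  have hP : ∀ x, tau r x {(b, a)} {(a, b)} = treeSum r x (fun t => t a = b) := by
    intro x
    refine tau_eq r x _ _ _ fun t ht => ?_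
    rw [Set.singleton_subset_iff, Set.inter_singleton_eq_empty, mem_edges_iff ht hab,
      mem_edges_iff ht hab.symm]
    exact ⟨fun h => h.2, fun h => ⟨fun h' => no_two_cycle hab ht h h', h⟩⟩
  have hQ : ∀ x, tau r x {(a, b)} {(b, a)} = treeSum r x (fun t => t b = a) := by
    intro x
    refine tau_eq r x _ _ _ fun t ht => ?_
    rw [Set.singleton_subset_iff, Set.inter_singleton_eq_empty, mem_edges_iff ht hab,
      mem_edges_iff ht hab.symm]
    exact ⟨fun h => h.2, fun h => ⟨fun h' => no_two_cycle hab ht h' h, h⟩⟩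
  have hB : tau r b ∅ {(a, b)} = treeSum r b (fun t => t a = b) := by
    refine tau_eq r b _ _ _ fun t ht => ?_
    rw [Set.singleton_subset_iff, Set.inter_empty, mem_edges_iff ht hab]
    simp
  have hPa : treeSum r a (fun t => t a = b) = 0 := by
    refine Finset.sum_eq_zero fun t _ => if_neg ?_
    rintro ⟨h1, h2⟩
    exact hab (h1.1.symm.trans h2)
  have hQb : treeSum r b (fun t => t b = a) = 0 := by
    refine Finset.sum_eq_zero fun t _ => if_neg ?_
    rintro ⟨h1, h2⟩
    exact hab (h2.symm.trans h1.1)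
  have hswap := swap_sum r a b hab
  have hne : sigmaVec r a b ≠ 0 := by
    intro h
    have h0 := congrFun h 0
    obtain ⟨t, ht, hta, htp⟩ := exists_tree r hirr a b hab hpab
    have hpos := treeSum_pos r hr b (fun t => t a = b) t ht hta htp
    simp only [sigmaVec, Matrix.cons_val_zero, Pi.zero_apply, hB] at h0
    have := mul_pos hpba hpos
    linarith
  have horth : ∀ x : X, ∑ i, sigmaVec r a b i * tauVec r a b x i = 0 := by
    refine uniq r hr hirr a b _ ?_ ?_ ?_
    · simp [Fin.sum_univ_three, sigmaVec, tauVec, hT, hP, hQ, hB, hPa]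
      linear_combination (-treeSum r a (fun t => t a ≠ b ∧ t b ≠ a)) * hswap
    · simp [Fin.sum_univ_three, sigmaVec, tauVec, hT, hP, hQ, hB, hQb]
      ring
    · intro x hxa hxb
      have e1 := mctt r x (fun t => t a = b) (edge_update' hxa) (edge_update hab hxb)
      have e2 := mctt r x (fun t => t b = a) (edge_update' hxb) (edge_update hab.symm hxa)
      have e3 := mctt r x (fun t => t a ≠ b ∧ t b ≠ a)
        (fun f => and_congr (not_congr (edge_update' hxa f)) (not_congr (edge_update' hxb f)))
        (fun f y h => and_congr (not_congr (edge_update hab hxb f y h))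
          (not_congr (edge_update hab.symm hxa f y h)))
      have hv : ∀ y, ∑ i, sigmaVec r a b i * tauVec r a b y i =
          sigmaVec r a b 0 * treeSum r y (fun t => t a ≠ b ∧ t b ≠ a)
          + sigmaVec r a b 1 * treeSum r y (fun t => t a = b)
          + sigmaVec r a b 2 * treeSum r y (fun t => t b = a) := by
        intro y
        simp [Fin.sum_univ_three, tauVec, hT, hP, hQ]
      simp_rw [hv]
      have hd : ∑ y, r (y, x) * (sigmaVec r a b 0 * treeSum r y (fun t => t a ≠ b ∧ t b ≠ a)
          + sigmaVec r a b 1 * treeSum r y (fun t => t a = b)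
          + sigmaVec r a b 2 * treeSum r y (fun t => t b = a))
          = sigmaVec r a b 0 * ∑ y, r (y, x) * treeSum r y (fun t => t a ≠ b ∧ t b ≠ a)
          + sigmaVec r a b 1 * ∑ y, r (y, x) * treeSum r y (fun t => t a = b)
          + sigmaVec r a b 2 * ∑ y, r (y, x) * treeSum r y (fun t => t b = a) := by
        simp only [Finset.mul_sum, ← Finset.sum_add_distrib]
        refine Finset.sum_congr rfl fun y _ => ?_
        ring
      rw [hd, e1, e2, e3]
      ring
  refine ⟨hne, horth, ?_⟩
  have hlt : Submodule.span ℝ (Set.range (tauVec r a b)) ≠ ⊤ := by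
    intro htop
    have hall : ∀ v : Fin 3 → ℝ, ∑ i, sigmaVec r a b i * v i = 0 := by
      intro v
      have hv : v ∈ Submodule.span ℝ (Set.range (tauVec r a b)) := htop ▸ Submodule.mem_top
      induction hv using Submodule.span_induction with
      | mem v h => obtain ⟨x, rfl⟩ := h; exact horth x
      | zero => simp
      | add u v _ _ hu hv => simp [mul_add, Finset.sum_add_distrib, hu, hv]
      | smul c v _ hv =>
        have : ∑ i, sigmaVec r a b i * (c • v) i = c * ∑ i, sigmaVec r a b i * v i := by
          rw [Finset.mul_sum]
          refine Finset.sum_congr rfl fun i _ => ?_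
          simp only [Pi.smul_apply, smul_eq_mul]
          ring
        rw [this, hv, mul_zero]
    apply hne
    funext i
    have h := (Finset.sum_eq_zero_iff_of_nonneg
      (fun i _ => mul_self_nonneg (sigmaVec r a b i))).1 (hall _) i (Finset.mem_univ i)
    exact mul_self_eq_zero.1 h
  have h3 := Submodule.finrank_lt hlt
  rw [Module.finrank_fin_fun] at h3
  omega
end
end

section
/- Positivity of conditioned spanning-tree polynomials: let x ∈ X, let A ⊆ X × X, and let B ⊆ X × X be a set of present edges, disjoint from A, such that every edge of B has target x, no edge of B has source x, and the sources of the edges of B are pairwise distinct. If the graph obtained by deleting all edges of A (setting their rates to 0) is irreducible, then τ_x^{∖A ∥B} > 0, i.e. there exists a rooted spanning tree with root x avoiding A and containing B. In particular (B = ∅) τ_x^{∖A} > 0 for every x, and (A = ∅, B = {(a,b)}, x = b) if the original graph is irreducible and r(a,b) > 0 with a ≠ b then τ_b^{∥{(a,b)}} > 0. -/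
open scoped Classical

noncomputable section

theorem exists_dist {X : Type*} (q : X × X → ℝ) (x : X) (h : Irreducible' q) :
    ∃ d : X → ℕ, ∀ y, y ≠ x → ∃ z, 0 < q (y, z) ∧ d z < d y := by
  have hex : ∀ y : X, ∃ n : ℕ, ∃ f : ℕ → X,
      f 0 = y ∧ f n = x ∧ ∀ i < n, 0 < q (f i, f (i + 1)) := by
    intro y
    by_cases hy : y = x
    · exact ⟨0, fun _ => x, hy.symm, rfl, fun i hi => absurd hi (Nat.not_lt_zero i)⟩
    · exact h y x hy
  refine ⟨fun y => Nat.find (hex y), fun y hy => ?_⟩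
  obtain ⟨f, h0, hn, hp⟩ := Nat.find_spec (hex y)
  have hpos : 0 < Nat.find (hex y) := by
    rcases Nat.eq_zero_or_pos (Nat.find (hex y)) with h1 | h1
    · rw [h1, h0] at hn
      exact absurd hn hy
    · exact h1
  refine ⟨f 1, ?_, ?_⟩
  · have := hp 0 hpos
    rwa [h0] at this
  · have hle : Nat.find (hex (f 1)) ≤ Nat.find (hex y) - 1 := by
      apply Nat.find_min'
      refine ⟨fun i => f (i + 1), rfl, ?_, fun i hi => hp (i + 1) (by omega)⟩
      show f (Nat.find (hex y) - 1 + 1) = x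
      rw [Nat.sub_add_cancel hpos, hn]
    show Nat.find (hex (f 1)) < Nat.find (hex y)
    omega

theorem tau_pos {X : Type*} [Fintype X] (r : X × X → ℝ) (hr : ∀ e, 0 ≤ r e)
    (x : X) (A B : Set (X × X)) (hB : ∀ e ∈ B, 0 < r e) (hAB : Disjoint A B)
    (hBx : ∀ e ∈ B, e.2 = x) (hBs : ∀ e ∈ B, e.1 ≠ x)
    (h : Irreducible' (fun e => if e ∈ A then 0 else r e)) : 0 < tau r x A B := by
  obtain ⟨d, hd⟩ := exists_dist _ x h
  have hd2 : ∀ y, ∃ z, y ≠ x → (0 < r (y, z) ∧ (y, z) ∉ A ∧ d z < d y) := by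
    intro y
    by_cases hy : y = x
    · exact ⟨x, fun h => absurd hy h⟩
    · obtain ⟨z, hz, hlt⟩ := hd y hy
      refine ⟨z, fun _ => ?_⟩
      by_cases hA : (y, z) ∈ A
      · simp [hA] at hz
      · simp only [hA, if_false] at hz
        exact ⟨hz, hA, hlt⟩
  choose g hg using hd2
  let t : X → X := fun y => if y = x ∨ (y, x) ∈ B then x else g y
  have htx : t x = x := by simp [t]
  have htB : ∀ y, (y, x) ∈ B → t y = x := fun y hy => by simp [t, hy]
  have hedge : ∀ y, y ≠ x → 0 < r (y, t y) ∧ (y, t y) ∉ A := by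
    intro y hy
    by_cases hyB : (y, x) ∈ B
    · rw [htB y hyB]
      exact ⟨hB _ hyB, fun hA => Set.disjoint_left.mp hAB hA hyB⟩
    · have : t y = g y := by simp [t, hy, hyB]
      rw [this]
      exact ⟨(hg y hy).1, (hg y hy).2.1⟩
  have hreach : ∀ n y, d y < n → ∃ k : ℕ, t^[k] y = x := by
    intro n
    induction n with
    | zero => intro y hy; omega
    | succ n ih =>
      intro y hyn
      by_cases hy : y = x
      · exact ⟨0, hy⟩
      by_cases hyB : (y, x) ∈ B
      · exact ⟨1, htB y hyB⟩
      · have hty : t y = g y := by simp [t, hy, hyB]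
        have h3 := (hg y hy).2.2
        obtain ⟨k, hk⟩ := ih (g y) (by omega)
        exact ⟨k + 1, by rw [Function.iterate_succ_apply, hty, hk]⟩
  have ht : IsRootedTree x t ∧ treeEdges x t ∩ A = ∅ ∧ B ⊆ treeEdges x t := by
    refine ⟨⟨htx, fun y => hreach (d y + 1) y (Nat.lt_succ_self _)⟩, ?_, ?_⟩
    · rw [Set.eq_empty_iff_forall_notMem]
      rintro ⟨u, v⟩ ⟨⟨hu, hv⟩, hA⟩
      simp only at hu hv
      subst hv
      exact (hedge u hu).2 hA
    · rintro ⟨u, v⟩ he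
      have hv : v = x := hBx _ he
      have hu : u ≠ x := hBs _ he
      subst hv
      exact ⟨hu, (htB u he).symm⟩
  unfold tau
  refine Finset.sum_pos' (fun s _ => ?_) ⟨t, Finset.mem_univ t, ?_⟩
  · split_ifs
    · exact Finset.prod_nonneg fun y _ => hr _
    · exact le_rfl
  · rw [if_pos ht]
    exact Finset.prod_pos fun y hy => (hedge y (Finset.mem_filter.mp hy).2).1

theorem stmt_9 {X : Type*} [Fintype X] (r : X × X → ℝ) (hr : ∀ e, 0 ≤ r e) :
    (∀ (x : X) (A B : Set (X × X)),
      (∀ e ∈ B, 0 < r e) → Disjoint A B →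
      (∀ e ∈ B, e.2 = x) → (∀ e ∈ B, e.1 ≠ x) →
      Set.InjOn Prod.fst B →
      Irreducible' (fun e => if e ∈ A then 0 else r e) →
      0 < tau r x A B) ∧
    (∀ (x : X) (A : Set (X × X)),
      Irreducible' (fun e => if e ∈ A then 0 else r e) →
      0 < tau r x A ∅) ∧
    (∀ a b : X, a ≠ b → Irreducible' r → 0 < r (a, b) →
      0 < tau r b ∅ {(a, b)}) := by
  refine ⟨fun x A B hB hAB hBx hBs _ h => tau_pos r hr x A B hB hAB hBx hBs h,
    fun x A h => tau_pos r hr x A ∅ (by simp) (by simp) (by simp) (by simp) h,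
    fun a b hab h hpos => tau_pos r hr b ∅ {(a, b)} ?_ (by simp) (by simp) ?_ (by simpa using h)⟩
  · rintro e rfl
    exact hpos
  · rintro e rfl
    exact hab
end
end

section
/- Cancellation of quadratic terms in the pinned current: r(a,b)·τ_a − r(b,a)·τ_b = r(a,b)·τ_a^{∖{+1,−1}} − r(b,a)·τ_b^{∖{+1,−1}}, i.e. in the numerator of the stationary current through the pinned edge all terms containing the product r(a,b)·r(b,a) cancel. -/
open scoped Classical

noncomputable section

def flipRoot {X : Type*} (a b : X) (t : X → X) : X → X :=
  Function.update (Function.update t a b) b b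

lemma flipRoot_tree {X : Type*} {a b : X} (hab : a ≠ b) {t : X → X}
    (h : IsRootedTree a t) : IsRootedTree b (flipRoot a b t) := by
  refine ⟨by simp [flipRoot], fun y => ?_⟩
  obtain ⟨n, hn⟩ := h.2 y
  induction n generalizing y with
  | zero =>
    refine ⟨1, ?_⟩
    have : y = a := by simpa using hn
    subst this
    simp [flipRoot, hab]
  | succ n ih =>
    by_cases hb : y = b
    · exact ⟨0, by simpa using hb⟩
    by_cases ha : y = a
    · subst ha
      exact ⟨1, by simp [flipRoot, hab]⟩
    rw [Function.iterate_succ_apply] at hn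
    obtain ⟨m, hm⟩ := ih (t y) hn
    refine ⟨m + 1, ?_⟩
    rw [Function.iterate_succ_apply]
    have : flipRoot a b t y = t y := by simp [flipRoot, hb, ha]
    rw [this, hm]

lemma flipRoot_at {X : Type*} {a b : X} (hab : a ≠ b) (t : X → X) : flipRoot a b t a = b := by
  simp [flipRoot, hab]

lemma flipRoot_flipRoot {X : Type*} {a b : X} (hab : a ≠ b) {t : X → X}
    (h : IsRootedTree a t) (hb : t b = a) : flipRoot b a (flipRoot a b t) = t := by
  funext y
  have := h.1
  by_cases ha : y = a
  · subst ha; simp [flipRoot, this]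
  by_cases hb' : y = b
  · subst hb'; simp [flipRoot, ha, hb]
  simp [flipRoot, ha, hb']

lemma weight_flip {X : Type*} [Fintype X] (r : X × X → ℝ) {a b : X} (hab : a ≠ b) {t : X → X}
    (hb : t b = a) :
    r (a, b) * treeWeight r a t = r (b, a) * treeWeight r b (flipRoot a b t) := by
  unfold treeWeight
  have e1 : Finset.univ.filter (fun y => y ≠ a) =
      insert b (Finset.univ.filter (fun y => y ≠ a ∧ y ≠ b)) := by
    ext y; by_cases h : y = b <;> simp [h, hab.symm]
  have e2 : Finset.univ.filter (fun y => y ≠ b) =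
      insert a (Finset.univ.filter (fun y => y ≠ a ∧ y ≠ b)) := by
    ext y; by_cases h : y = a <;> simp [h, hab]
  rw [e1, e2, Finset.prod_insert (by simp), Finset.prod_insert (by simp), hb, flipRoot_at hab]
  have : ∏ y ∈ Finset.univ.filter (fun y => y ≠ a ∧ y ≠ b), r (y, flipRoot a b t y) =
      ∏ y ∈ Finset.univ.filter (fun y => y ≠ a ∧ y ≠ b), r (y, t y) := by
    refine Finset.prod_congr rfl fun y hy => ?_
    simp only [Finset.mem_filter] at hy
    simp [flipRoot, hy.2.1, hy.2.2]
  rw [this]; ring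

/-- Sum over the trees rooted at `a` which contain the edge `(b, a)`. -/
def tauEdge {X : Type*} [Fintype X] (r : X × X → ℝ) (a b : X) : ℝ :=
  ∑ t ∈ Finset.univ.filter (fun t : X → X => IsRootedTree a t ∧ t b = a), treeWeight r a t

lemma tauEdge_symm {X : Type*} [Fintype X] (r : X × X → ℝ) {a b : X} (hab : a ≠ b) :
    r (a, b) * tauEdge r a b = r (b, a) * tauEdge r b a := by
  unfold tauEdge
  rw [Finset.mul_sum, Finset.mul_sum]
  refine Finset.sum_bij' (fun t _ => flipRoot a b t) (fun t _ => flipRoot b a t) ?_ ?_ ?_ ?_ ?_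
  · intro t ht
    simp only [Finset.mem_filter, Finset.mem_univ, true_and] at ht ⊢
    exact ⟨flipRoot_tree hab ht.1, flipRoot_at hab t⟩
  · intro t ht
    simp only [Finset.mem_filter, Finset.mem_univ, true_and] at ht ⊢
    exact ⟨flipRoot_tree hab.symm ht.1, flipRoot_at hab.symm t⟩
  · intro t ht
    simp only [Finset.mem_filter, Finset.mem_univ, true_and] at ht
    exact flipRoot_flipRoot hab ht.1 ht.2
  · intro t ht
    simp only [Finset.mem_filter, Finset.mem_univ, true_and] at ht
    exact flipRoot_flipRoot hab.symm ht.1 ht.2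
  · intro t ht
    simp only [Finset.mem_filter, Finset.mem_univ, true_and] at ht
    exact weight_flip r hab ht.2

lemma tau_split {X : Type*} [Fintype X] (r : X × X → ℝ) {a b : X} (hab : a ≠ b) :
    tau r a ∅ ∅ = tau r a {(a, b), (b, a)} ∅ + tauEdge r a b := by
  unfold tau tauEdge
  rw [Finset.sum_filter, ← Finset.sum_add_distrib]
  refine Finset.sum_congr rfl fun t _ => ?_
  have key : treeEdges a t ∩ {(a, b), (b, a)} = ∅ ↔ t b ≠ a := by
    constructor
    · intro h hb
      have : (b, a) ∈ treeEdges a t ∩ {(a, b), (b, a)} :=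
        ⟨⟨hab.symm, hb.symm⟩, by simp⟩
      rw [h] at this
      exact this
    · intro h
      ext ⟨u, v⟩
      simp only [treeEdges, Set.mem_inter_iff, Set.mem_setOf_eq, Set.mem_insert_iff,
        Set.mem_singleton_iff, Prod.mk.injEq, Set.mem_empty_iff_false, iff_false]
      rintro ⟨⟨h1, h2⟩, ⟨h3, h4⟩ | ⟨h3, h4⟩⟩
      · exact h1 h3
      · subst h3; exact h (h2.symm.trans h4)
  simp only [key, Set.inter_empty, Set.empty_subset, and_true, true_and]
  by_cases h1 : IsRootedTree a t <;> by_cases h2 : t b = a <;> simp [h1, h2]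

theorem stmt_11 {X : Type*} [Fintype X] (r : X × X → ℝ) (hr : ∀ e, 0 ≤ r e)
    (a b : X) (hab : a ≠ b) (hpab : 0 < r (a, b)) (hpba : 0 < r (b, a)) :
    r (a, b) * tau r a ∅ ∅ - r (b, a) * tau r b ∅ ∅ =
      r (a, b) * tau r a {(a, b), (b, a)} ∅ - r (b, a) * tau r b {(a, b), (b, a)} ∅ := by
  have h1 := tau_split r hab
  have h2 := tau_split r hab.symm
  rw [Set.pair_comm] at h2
  have h3 := tauEdge_symm r hab
  rw [h1, h2]
  linear_combination h3
end
end

section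
/- Vanishing determinant of the current-coefficient matrix: let e = (u,v) be any ordered pair of distinct vertices of X. Define the 3×3 real matrix M with columns M₀ = (Σ_{x∈X} τ_x^{∖{+1,−1}}, Σ_{x∈X} τ_x^{∖{−1}∥{+1}}, Σ_{x∈X} τ_x^{∖{+1}∥{−1}}), M₁ = (0, r(a,b)·τ_a^{∖{+1,−1}}, −r(b,a)·τ_b^{∖{+1,−1}}), and M_e = (r(u,v)·τ_u^{∖{+1,−1}} − r(v,u)·τ_v^{∖{+1,−1}}, r(u,v)·τ_u^{∖{−1}∥{+1}} − r(v,u)·τ_v^{∖{−1}∥{+1}}, r(u,v)·τ_u^{∖{+1}∥{−1}} − r(v,u)·τ_v^{∖{+1}∥{−1}}). Then det M = 0. -/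
open scoped Classical

noncomputable section

/-- every vertex reaches `x` under iteration -/
def Reach {X : Type*} (f : X → X) (x : X) : Prop := ∀ y : X, ∃ n : ℕ, f^[n] y = x

theorem reach_of_agree {X : Type*} (f g : X → X) (x : X) (h : ∀ z, z ≠ x → f z = g z)
    (hf : Reach f x) : Reach g x := by
  intro y
  obtain ⟨n, hn⟩ := hf y
  induction n generalizing y with
  | zero => exact ⟨0, hn⟩
  | succ n ih =>
    by_cases hy : y = x
    · exact ⟨0, hy⟩
    · rw [Function.iterate_succ_apply, h y hy] at hn
      obtain ⟨m, hm⟩ := ih _ hn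
      exact ⟨m + 1, by rw [Function.iterate_succ_apply]; exact hm⟩

theorem reach_step {X : Type*} (f : X → X) (y : X) (h : Reach f y) : Reach f (f y) := by
  intro z
  obtain ⟨n, hn⟩ := h z
  exact ⟨n + 1, by rw [Function.iterate_succ_apply', hn]⟩

theorem reach_pred {X : Type*} (f : X → X) (x : X) (h : Reach f x) :
    ∃ y, f y = x ∧ Reach f y := by
  obtain ⟨n, hn⟩ := h (f x)
  refine ⟨f^[n] x, by rw [← Function.iterate_succ_apply' f, Function.iterate_succ_apply, hn], ?_⟩
  intro z
  obtain ⟨m, hm⟩ := h z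
  exact ⟨n + m, by rw [Function.iterate_add_apply, hm]⟩

theorem reach_unique {X : Type*} (f : X → X) (y z : X) (h : f y = f z) (hy : Reach f y)
    (hz : Reach f z) : y = z := by
  obtain ⟨m, hm⟩ := hz y
  obtain ⟨n, hn⟩ := hy z
  have h1 : f^[n + m] y = y := by rw [Function.iterate_add_apply, hm, hn]
  have h2 : f^[n + m] z = z := by rw [add_comm, Function.iterate_add_apply, hn, hm]
  cases hk : n + m with
  | zero =>
    have : m = 0 := by omega
    subst this
    exact hm
  | succ k =>
    rw [hk, Function.iterate_succ_apply] at h1 h2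
    rw [← h1, ← h2, h]

theorem sum_reach {X : Type*} [Fintype X] (f : X → X) (x : X) (w : ℝ) :
    (∑ y, if f y = x ∧ Reach f y then w else 0) = if Reach f x then w else 0 := by
  by_cases h : Reach f x
  · obtain ⟨y, hy, hr⟩ := reach_pred f x h
    rw [if_pos h, Finset.sum_eq_single y]
    · rw [if_pos ⟨hy, hr⟩]
    · intro z _ hz
      rw [if_neg]
      rintro ⟨h1, h2⟩
      exact hz (reach_unique f z y (h1.trans hy.symm) h2 hr)
    · simp
  · rw [if_neg h]
    apply Finset.sum_eq_zero
    intro y _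
    rw [if_neg]
    rintro ⟨rfl, h2⟩
    exact h (reach_step f y h2)

theorem tau_eq_s12 {X : Type*} [Fintype X] (r : X × X → ℝ) (x : X) :
    tau r x ∅ ∅ = ∑ t : X → X, if t x = x ∧ Reach t x then treeWeight r x t else 0 := by
  unfold tau
  apply Finset.sum_congr rfl
  intro t _
  have : (IsRootedTree x t ∧ treeEdges x t ∩ ∅ = ∅ ∧ ∅ ⊆ treeEdges x t) ↔
      (t x = x ∧ Reach t x) := by
    simp [IsRootedTree, Reach]
  simp only [this]

theorem mul_tau {X : Type*} [Fintype X] (r : X × X → ℝ) (x y : X) :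
    r (x, y) * tau r x ∅ ∅ =
      ∑ f : X → X, if f x = y ∧ Reach f x then ∏ z, r (z, f z) else 0 := by
  rw [tau_eq_s12, Finset.mul_sum]
  simp_rw [mul_ite, mul_zero]
  rw [← Finset.sum_filter, ← Finset.sum_filter]
  refine Finset.sum_bij' (fun t _ => Function.update t x y) (fun f _ => Function.update f x x)
    ?_ ?_ ?_ ?_ ?_
  · intro t ht
    simp only [Finset.mem_filter, Finset.mem_univ, true_and] at ht ⊢
    refine ⟨by simp, reach_of_agree t _ x ?_ ht.2⟩
    intro z hz; simp [hz]
  · intro t ht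
    simp only [Finset.mem_filter, Finset.mem_univ, true_and] at ht ⊢
    refine ⟨by simp, reach_of_agree t _ x ?_ ht.2⟩
    intro z hz; simp [hz]
  · intro t ht
    simp only [Finset.mem_filter, Finset.mem_univ, true_and] at ht
    simp only [Function.update_idem]
    conv_lhs => rw [← ht.1]
    rw [ht.1]; nth_rw 2 [← ht.1]; simp
  · intro t ht
    simp only [Finset.mem_filter, Finset.mem_univ, true_and] at ht
    simp only [Function.update_idem]
    rw [← ht.1]; simp
  · intro t ht
    rw [← Finset.mul_prod_erase Finset.univ _ (Finset.mem_univ x)]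
    unfold treeWeight
    simp only [Function.update_self]
    congr 1
    rw [Finset.filter_ne']
    apply Finset.prod_congr rfl
    intro z hz
    rw [Function.update_of_ne (Finset.ne_of_mem_erase hz)]

/-- Markov chain tree theorem (balance). -/
theorem balance {X : Type*} [Fintype X] (r : X × X → ℝ) (x : X) :
    ∑ y, r (y, x) * tau r y ∅ ∅ = (∑ y, r (x, y)) * tau r x ∅ ∅ := by
  rw [Finset.sum_mul]
  simp_rw [mul_tau]
  rw [Finset.sum_comm]
  conv_rhs => rw [Finset.sum_comm]
  apply Finset.sum_congr rfl
  intro f _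
  rw [sum_reach]
  by_cases h : Reach f x
  · simp [h]
  · simp [h]

/-- scaled rates -/
def rst {X : Type*} (r : X × X → ℝ) (a b : X) (s t : ℝ) (e : X × X) : ℝ :=
  (if e = (a, b) then s else 1) * (if e = (b, a) then t else 1) * r e

theorem prod_coef {X : Type*} [Fintype X] (x a b : X) (s : ℝ) (f : X → X) :
    (∏ y ∈ Finset.univ.filter (fun y => y ≠ x), if (y, f y) = (a, b) then s else 1)
      = if (a, b) ∈ treeEdges x f then s else 1 := by
  by_cases h : (a, b) ∈ treeEdges x f
  · rw [if_pos h]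
    obtain ⟨h1, h2⟩ := h
    simp only at h1 h2
    rw [Finset.prod_eq_single a]
    · simp [h2]
    · intro y _ hy; simp [hy]
    · simp [h1]
  · rw [if_neg h]
    apply Finset.prod_eq_one
    intro y hy
    rw [if_neg]
    intro he
    simp only [Prod.mk.injEq] at he
    obtain ⟨rfl, rfl⟩ := he
    exact h ⟨by simpa using hy, rfl⟩

theorem weight_rst {X : Type*} [Fintype X] (r : X × X → ℝ) (x a b : X) (s t : ℝ) (f : X → X) :
    treeWeight (rst r a b s t) x f = (if (a, b) ∈ treeEdges x f then s else 1) *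
      (if (b, a) ∈ treeEdges x f then t else 1) * treeWeight r x f := by
  rw [← prod_coef, ← prod_coef]
  unfold treeWeight rst
  rw [Finset.prod_mul_distrib, Finset.prod_mul_distrib]

theorem not_both {X : Type*} (x a b : X) (f : X → X) (hf : IsRootedTree x f)
    (h1 : (a, b) ∈ treeEdges x f) (h2 : (b, a) ∈ treeEdges x f) : False := by
  obtain ⟨n, hn⟩ := hf.2 a
  have key : ∀ n, f^[n] a = a ∨ f^[n] a = b := by
    intro n
    induction n with
    | zero => left; rfl
    | succ n ih =>
      rw [Function.iterate_succ_apply']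
      rcases ih with h | h
      · right; rw [h]; exact h1.2.symm
      · left; rw [h]; exact h2.2.symm
  rcases key n with h | h
  · exact h1.1 (h.symm.trans hn)
  · exact h2.1 (h.symm.trans hn)

theorem tau_rst {X : Type*} [Fintype X] (r : X × X → ℝ) (x a b : X) (s t : ℝ) :
    tau (rst r a b s t) x ∅ ∅ = tau r x {(a, b), (b, a)} ∅ + s * tau r x {(b, a)} {(a, b)}
      + t * tau r x {(a, b)} {(b, a)} := by
  unfold tau
  rw [Finset.mul_sum, Finset.mul_sum, ← Finset.sum_add_distrib, ← Finset.sum_add_distrib]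
  apply Finset.sum_congr rfl
  intro f _
  rw [weight_rst]
  have e1 : treeEdges x f ∩ {(a, b), (b, a)} = ∅ ↔
      (a, b) ∉ treeEdges x f ∧ (b, a) ∉ treeEdges x f := by
    rw [Set.inter_comm, ← Set.disjoint_iff_inter_eq_empty, Set.disjoint_insert_left,
      Set.disjoint_singleton_left]
  simp only [e1, Set.inter_singleton_eq_empty, Set.singleton_subset_iff, Set.inter_empty,
    Set.empty_subset, and_true]
  by_cases hf : IsRootedTree x f
  · by_cases h1 : (a, b) ∈ treeEdges x f
    · by_cases h2 : (b, a) ∈ treeEdges x f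
      · exact (not_both x a b f hf h1 h2).elim
      · simp [hf, h1, h2]
    · by_cases h2 : (b, a) ∈ treeEdges x f
      · simp [hf, h1, h2]
      · simp [hf, h1, h2]
  · simp [hf]

/-- net inflow minus outflow -/
def gen {X : Type*} [Fintype X] (r : X × X → ℝ) (w : X → ℝ) (x : X) : ℝ :=
  ∑ y, r (y, x) * w y - (∑ y, r (x, y)) * w x

theorem rst_split {X : Type*} (r : X × X → ℝ) (a b : X) (hab : a ≠ b) (s t : ℝ) (y x : X) :
    rst r a b s t (y, x) = rst r a b 0 0 (y, x) + s * (if y = a then if x = b then r (a, b) else 0 else 0)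
      + t * (if y = b then if x = a then r (b, a) else 0 else 0) := by
  unfold rst
  by_cases h1 : y = a <;> by_cases h2 : x = b <;> by_cases h3 : y = b <;> by_cases h4 : x = a <;>
    simp_all

theorem gen_rst {X : Type*} [Fintype X] (r : X × X → ℝ) (a b : X) (hab : a ≠ b) (s t : ℝ)
    (w : X → ℝ) (x : X) :
    gen (rst r a b s t) w x = gen (rst r a b 0 0) w x
      + s * (r (a, b) * w a) * ((if x = b then 1 else 0) - (if x = a then 1 else 0))
      - t * (r (b, a) * w b) * ((if x = b then 1 else 0) - (if x = a then 1 else 0)) := by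
  unfold gen
  simp_rw [rst_split r a b hab s t]
  simp only [add_mul, Finset.sum_add_distrib, mul_assoc, ← Finset.mul_sum, ite_mul, zero_mul,
    Finset.sum_ite_eq', Finset.mem_univ, if_true]
  by_cases h1 : x = a <;> by_cases h2 : x = b
  · exact (hab (h1.symm.trans h2)).elim
  all_goals simp [h1, h2, hab, hab.symm]
  all_goals ring

theorem gen_lin {X : Type*} [Fintype X] (r : X × X → ℝ) (u v w : X → ℝ) (c d e : ℝ) (x : X) :
    gen r (fun y => c * u y + d * v y + e * w y) x
      = c * gen r u x + d * gen r v x + e * gen r w x := by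
  unfold gen
  have : ∀ y, r (y, x) * (c * u y + d * v y + e * w y) =
    c * (r (y, x) * u y) + d * (r (y, x) * v y) + e * (r (y, x) * w y) := fun y => by ring
  simp_rw [this]
  rw [Finset.sum_add_distrib, Finset.sum_add_distrib, ← Finset.mul_sum, ← Finset.mul_sum,
    ← Finset.mul_sum]
  ring

theorem gen_coef {X : Type*} [Fintype X] (r : X × X → ℝ) (a b : X) (hab : a ≠ b) (x : X) :
    gen (rst r a b 0 0) (fun y => tau r y {(a, b), (b, a)} ∅) x = 0 ∧
    gen (rst r a b 0 0) (fun y => tau r y {(b, a)} {(a, b)}) x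
      = - (r (a, b) * tau r a {(a, b), (b, a)} ∅) *
        ((if x = b then 1 else 0) - (if x = a then 1 else 0)) ∧
    gen (rst r a b 0 0) (fun y => tau r y {(a, b)} {(b, a)}) x
      = (r (b, a) * tau r b {(a, b), (b, a)} ∅) *
        ((if x = b then 1 else 0) - (if x = a then 1 else 0)) := by
  have key : ∀ s t : ℝ, gen (rst r a b s t) (fun y => 1 * tau r y {(a, b), (b, a)} ∅
      + s * tau r y {(b, a)} {(a, b)} + t * tau r y {(a, b)} {(b, a)}) x = 0 := by
    intro s t
    have h := balance (rst r a b s t) x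
    simp_rw [tau_rst] at h
    unfold gen
    simp only [one_mul]
    linarith
  replace key := fun s t => (gen_rst r a b hab s t _ x).symm.trans (key s t)
  simp_rw [gen_lin] at key
  generalize ((if x = b then 1 else 0) - (if x = a then 1 else 0) : ℝ) = D at *
  have h0 := key 0 0
  have h1 := key 1 0
  have h2 := key (-1) 0
  have h3 := key 0 1
  have h4 := key 0 (-1)
  refine ⟨?_, ?_, ?_⟩ <;> linarith

theorem nonneg_ker {X : Type*} [Fintype X] (r : X × X → ℝ) (a b c : X) (hca : c ≠ a) (hcb : c ≠ b)
    (hr : ∀ e, 0 ≤ r e) (hpos : ∀ x y, ¬ (x = a ∧ y = b) → ¬ (x = b ∧ y = a) → 0 < r (x, y))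
    (w : X → ℝ) (hw : ∀ x, 0 ≤ w x) (h : ∀ x, gen r w x = 0) (x : X) (hx : w x = 0) (y : X) :
    w y = 0 := by
  have step : ∀ x, w x = 0 → ∀ y, 0 < r (y, x) → w y = 0 := by
    intro x hx y hy
    have h1 := h x
    unfold gen at h1
    rw [hx, mul_zero, sub_zero,
      Finset.sum_eq_zero_iff_of_nonneg (fun z _ => mul_nonneg (hr _) (hw z))] at h1
    have := h1 y (Finset.mem_univ y)
    rcases mul_eq_zero.1 this with h2 | h2
    · exact absurd h2 hy.ne'
    · exact h2
  have hc : w c = 0 := step x hx c (hpos c x (by tauto) (by tauto))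
  exact step c hc y (hpos y c (by tauto) (by tauto))

theorem ker_zero {X : Type*} [Fintype X] (r : X × X → ℝ) (a b c : X) (hca : c ≠ a) (hcb : c ≠ b)
    (hr : ∀ e, 0 ≤ r e) (hpos : ∀ x y, ¬ (x = a ∧ y = b) → ¬ (x = b ∧ y = a) → 0 < r (x, y))
    (w : X → ℝ) (h : ∀ x, gen r w x = 0) (hs : ∑ x, w x = 0) (x : X) :
    w x = 0 := by
  -- |w| is in the kernel
  have hle : ∀ x, 0 ≤ gen r (fun y => |w y|) x := by
    intro x
    have h1 := h x
    unfold gen at h1 ⊢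
    have h2 : 0 ≤ ∑ y, r (x, y) := Finset.sum_nonneg fun y _ => hr _
    have h3 : |∑ y, r (y, x) * w y| ≤ ∑ y, r (y, x) * |w y| := by
      refine (Finset.abs_sum_le_sum_abs _ _).trans (le_of_eq ?_)
      apply Finset.sum_congr rfl
      intro y _
      rw [abs_mul, abs_of_nonneg (hr _)]
    rw [sub_eq_zero.1 h1, abs_mul, abs_of_nonneg h2] at h3
    linarith
  have hsum : ∑ x, gen r (fun y => |w y|) x = 0 := by
    unfold gen
    rw [Finset.sum_sub_distrib, Finset.sum_comm]
    simp_rw [Finset.sum_mul]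
    simp
  have habs : ∀ x, gen r (fun y => |w y|) x = 0 := fun x =>
    (Finset.sum_eq_zero_iff_of_nonneg (fun x _ => hle x)).1 hsum x (Finset.mem_univ x)
  have hp : ∀ x, gen r (fun y => 1 * |w y| + 1 * w y + 0 * w y) x = 0 := by
    intro x; rw [gen_lin, habs, h]; ring
  have hm : ∀ x, gen r (fun y => 1 * |w y| + (-1) * w y + 0 * w y) x = 0 := by
    intro x; rw [gen_lin, habs, h]; ring
  have hp' := nonneg_ker r a b c hca hcb hr hpos _
    (fun y => by have := neg_abs_le (w y); linarith) hp
  have hm' := nonneg_ker r a b c hca hcb hr hpos _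
    (fun y => by have := le_abs_self (w y); linarith) hm
  rcases le_total 0 (w x) with hx | hx
  · have : ∀ y, 0 ≤ w y := by
      intro y
      have := hm' x (by rw [abs_of_nonneg hx]; ring) y
      have := abs_nonneg (w y)
      linarith
    exact (Finset.sum_eq_zero_iff_of_nonneg (fun x _ => this x)).1 hs x (Finset.mem_univ x)
  · have : ∀ y, w y ≤ 0 := by
      intro y
      have := hp' x (by rw [abs_of_nonpos hx]; ring) y
      have := abs_nonneg (w y)
      linarith
    exact (Finset.sum_eq_zero_iff_of_nonpos (fun x _ => this x)).1 hs x (Finset.mem_univ x)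

theorem tau_two {X : Type*} [Fintype X] (r : X × X → ℝ) (a b : X) (hab : a ≠ b)
    (h : ∀ c, c = a ∨ c = b) (A : Set (X × X)) (hA : (b, a) ∈ A) : tau r a A ∅ = 0 := by
  unfold tau
  apply Finset.sum_eq_zero
  intro f _
  rw [if_neg]
  rintro ⟨h1, h2, -⟩
  rcases h (f b) with hb | hb
  · have : (b, a) ∈ treeEdges a f ∩ A := ⟨⟨hab.symm, hb.symm⟩, hA⟩
    rw [h2] at this
    exact this
  · obtain ⟨n, hn⟩ := h1.2 b
    rw [Function.iterate_fixed hb] at hn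
    exact hab hn.symm

theorem det_pos {X : Type*} [Fintype X] (r : X × X → ℝ) (hr : ∀ e, 0 < r e)
    (a b : X) (hab : a ≠ b) (x : X) (c0 c1 c2 : ℝ)
    (h1 : c1 * (r (a, b) * tau r a {(a, b), (b, a)} ∅)
      = c2 * (r (b, a) * tau r b {(a, b), (b, a)} ∅))
    (h0 : c0 * ∑ x, tau r x {(a, b), (b, a)} ∅ + c1 * ∑ x, tau r x {(b, a)} {(a, b)}
      + c2 * ∑ x, tau r x {(a, b)} {(b, a)} = 0) (hc : ∃ c, c ≠ a ∧ c ≠ b) :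
    c0 * tau r x {(a, b), (b, a)} ∅ + c1 * tau r x {(b, a)} {(a, b)}
      + c2 * tau r x {(a, b)} {(b, a)} = 0 := by
  obtain ⟨c, hca, hcb⟩ := hc
  refine ker_zero (rst r a b 0 0) a b c hca hcb ?_ ?_ (fun x =>
    c0 * tau r x {(a, b), (b, a)} ∅ + c1 * tau r x {(b, a)} {(a, b)}
      + c2 * tau r x {(a, b)} {(b, a)}) ?_ ?_ x
  · intro e
    unfold rst
    have := (hr e).le
    split_ifs <;> simp [this]
  · intro x y h1 h2
    unfold rst
    simp [h1, h2, hr]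
  · intro x
    rw [gen_lin]
    obtain ⟨e0, e1, e2⟩ := gen_coef r a b hab x
    rw [e0, e1, e2]
    linear_combination (-((if x = b then 1 else 0) - (if x = a then 1 else 0))) * h1
  · rw [Finset.sum_add_distrib, Finset.sum_add_distrib, ← Finset.mul_sum, ← Finset.mul_sum,
      ← Finset.mul_sum]
    exact h0

/-- expanded determinant -/
def detF {X : Type*} [Fintype X] (r : X × X → ℝ) (a b u v : X) : ℝ :=
    Matrix.det (Matrix.of fun (i j : Fin 3) =>
      ![![∑ x, tau r x {(a, b), (b, a)} ∅,
          ∑ x, tau r x {(b, a)} {(a, b)},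
          ∑ x, tau r x {(a, b)} {(b, a)}],
        ![0,
          r (a, b) * tau r a {(a, b), (b, a)} ∅,
          -(r (b, a) * tau r b {(a, b), (b, a)} ∅)],
        ![r (u, v) * tau r u {(a, b), (b, a)} ∅ - r (v, u) * tau r v {(a, b), (b, a)} ∅,
          r (u, v) * tau r u {(b, a)} {(a, b)} - r (v, u) * tau r v {(b, a)} {(a, b)},
          r (u, v) * tau r u {(a, b)} {(b, a)} - r (v, u) * tau r v {(a, b)} {(b, a)}]] j i)

theorem detF_pos {X : Type*} [Fintype X] (r : X × X → ℝ) (hr : ∀ e, 0 < r e)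
    (a b u v : X) (hab : a ≠ b) : detF r a b u v = 0 := by
  unfold detF
  rw [Matrix.det_fin_three]
  simp only [Matrix.of_apply, Matrix.cons_val]
  by_cases hc : ∃ c, c ≠ a ∧ c ≠ b
  · have key := fun x c0 c1 c2 h1 h0 => det_pos r hr a b hab x c0 c1 c2 h1 h0 hc
    generalize (∑ x, tau r x {(a, b), (b, a)} ∅) = S0 at *
    generalize (∑ x, tau r x {(b, a)} {(a, b)}) = S1 at *
    generalize (∑ x, tau r x {(a, b)} {(b, a)}) = S2 at *
    generalize (r (a, b) * tau r a {(a, b), (b, a)} ∅) = A at *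
    generalize (r (b, a) * tau r b {(a, b), (b, a)} ∅) = B at *
    have k := fun x => key x (-(S1 * B) - S2 * A) (S0 * B) (S0 * A) (by ring) (by ring)
    linear_combination r (u, v) * k u - r (v, u) * k v
  · have h : ∀ c, c = a ∨ c = b := by
      intro c
      by_contra hh
      push Not at hh
      exact hc ⟨c, hh⟩
    rw [tau_two r a b hab h _ (by simp), tau_two r b a hab.symm (fun c => (h c).symm) _ (by simp)]
    ring

theorem continuous_tau {X : Type*} [Fintype X] (r : X × X → ℝ) (x : X) (A B : Set (X × X)) :
    Continuous fun ε : ℝ => tau (fun e => r e + ε) x A B := by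
  unfold tau treeWeight
  refine continuous_finsetSum _ fun t _ => ?_
  split_ifs <;> fun_prop

theorem continuous_detF {X : Type*} [Fintype X] (r : X × X → ℝ) (a b u v : X) :
    Continuous fun ε : ℝ => detF (fun e => r e + ε) a b u v := by
  unfold detF
  simp only [Matrix.det_fin_three, Matrix.of_apply, Matrix.cons_val]
  have := continuous_tau r
  fun_prop

theorem stmt_12 {X : Type*} [Fintype X] (r : X × X → ℝ) (hr : ∀ e, 0 ≤ r e)
    (a b : X) (hab : a ≠ b) (hpab : 0 < r (a, b)) (hpba : 0 < r (b, a))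
    (u v : X) (huv : u ≠ v) :
    Matrix.det (Matrix.of fun (i j : Fin 3) =>
      ![![∑ x, tau r x {(a, b), (b, a)} ∅,
          ∑ x, tau r x {(b, a)} {(a, b)},
          ∑ x, tau r x {(a, b)} {(b, a)}],
        ![0,
          r (a, b) * tau r a {(a, b), (b, a)} ∅,
          -(r (b, a) * tau r b {(a, b), (b, a)} ∅)],
        ![r (u, v) * tau r u {(a, b), (b, a)} ∅ - r (v, u) * tau r v {(a, b), (b, a)} ∅,
          r (u, v) * tau r u {(b, a)} {(a, b)} - r (v, u) * tau r v {(b, a)} {(a, b)},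
          r (u, v) * tau r u {(a, b)} {(b, a)} - r (v, u) * tau r v {(a, b)} {(b, a)}]] j i)
      = 0 := by

  change detF r a b u v = 0
  have hc := continuous_detF r a b u v
  have h1 : Filter.Tendsto (fun ε : ℝ => detF (fun e => r e + ε) a b u v)
      (nhdsWithin 0 (Set.Ioi 0)) (nhds (detF r a b u v)) := by
    have := (hc.tendsto 0).mono_left (nhdsWithin_le_nhds (s := Set.Ioi (0 : ℝ)))
    simpa using this
  have h2 : Filter.Tendsto (fun ε : ℝ => detF (fun e => r e + ε) a b u v)
      (nhdsWithin 0 (Set.Ioi 0)) (nhds 0) := by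
    refine tendsto_const_nhds.congr' ?_
    filter_upwards [self_mem_nhdsWithin] with ε hε
    exact (detF_pos _ (fun e => add_pos_of_nonneg_of_pos (hr e) hε) a b u v hab).symm
  exact tendsto_nhds_unique h1 h2
end
end

section
/- Mutual linearity of stationary currents: for every ordered pair e = (u,v) of distinct vertices there exist real numbers λ⁰_e and λ¹_e, depending on the fixed rates but not on p and m, such that j_e(p,m) = λ⁰_e + λ¹_e · j_1(p,m) for all p, m ≥ 0. -/
open scoped Classical

noncomputable section

/-- The rate function with the pinned rates `r(a,b) = p` and `r(b,a) = m` substituted. -/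
def ratePM {X : Type*} (r : X × X → ℝ) (a b : X) (p m : ℝ) : X × X → ℝ :=
  fun e => if e = (a, b) then p else if e = (b, a) then m else r e

/-- The stationary current through the ordered pair `(u,v)`:
`(r(u,v) τ_u − r(v,u) τ_v) / Σ_x τ_x`. -/
def current {X : Type*} [Fintype X] (r : X × X → ℝ) (u v : X) : ℝ :=
  (r (u, v) * tau r u ∅ ∅ - r (v, u) * tau r v ∅ ∅) / ∑ x, tau r x ∅ ∅

/-- Every vertex reaches `x` under iteration. -/
def Reach13 {X : Type*} (x : X) (f : X → X) : Prop := ∀ z, ∃ n : ℕ, f^[n] z = x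

lemma reach13_congr {X : Type*} (y : X) (t f : X → X) (h : ∀ z, z ≠ y → f z = t z)
    (n : ℕ) : ∀ z, t^[n] z = y → ∃ m : ℕ, f^[m] z = y := by
  induction n with
  | zero => intro z hz; exact ⟨0, hz⟩
  | succ n ih =>
    intro z hz
    by_cases hzy : z = y
    · exact ⟨0, hzy⟩
    · rw [Function.iterate_succ_apply] at hz
      obtain ⟨m, hm⟩ := ih _ hz
      refine ⟨m + 1, ?_⟩
      rw [Function.iterate_succ_apply, h z hzy, hm]

lemma tau13 {X : Type*} [Fintype X] (r : X × X → ℝ) (x : X) :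
    tau r x ∅ ∅ = ∑ t : X → X with IsRootedTree x t, treeWeight r x t := by
  unfold tau
  rw [Finset.sum_filter]
  simp

lemma weight13 {X : Type*} [Fintype X] (r : X × X → ℝ) (x y : X) (t : X → X) :
    r (x, y) * treeWeight r x t = ∏ z, r (z, Function.update t x y z) := by
  unfold treeWeight
  rw [Finset.filter_ne', ← Finset.mul_prod_erase Finset.univ _ (Finset.mem_univ x)]
  congr 1
  · simp
  · apply Finset.prod_congr rfl
    intro z hz
    rw [Function.update_of_ne (Finset.ne_of_mem_erase hz)]

lemma out13 {X : Type*} [Fintype X] (r : X × X → ℝ) (x : X) :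
    ∑ y, r (x, y) * tau r x ∅ ∅ = ∑ f : X → X with Reach13 x f, ∏ z, r (z, f z) := by
  simp_rw [tau13, Finset.mul_sum]
  rw [← Finset.sum_product']
  refine Finset.sum_bij (fun q _ => Function.update q.2 x q.1) ?_ ?_ ?_ ?_
  · rintro ⟨y, t⟩ h
    simp only [Finset.mem_product, Finset.mem_univ, Finset.mem_filter, true_and] at h ⊢
    intro z
    obtain ⟨n, hn⟩ := h.2 z
    exact reach13_congr x t _ (fun w hw => Function.update_of_ne hw _ _) n z hn
  · rintro ⟨y, t⟩ h ⟨y', t'⟩ h' he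
    simp only [Finset.mem_product, Finset.mem_univ, Finset.mem_filter, true_and] at h h' he
    have h1 := congrFun he x
    simp only [Function.update_self] at h1
    refine Prod.ext h1 (funext fun z => ?_)
    by_cases hz : z = x
    · subst hz; exact h.1.trans h'.1.symm
    · have := congrFun he z
      simpa [Function.update_of_ne hz] using this
  · intro f hf
    simp only [Finset.mem_filter, Finset.mem_univ, true_and] at hf
    refine ⟨(f x, Function.update f x x), ?_, ?_⟩
    · simp only [Finset.mem_product, Finset.mem_univ, Finset.mem_filter, true_and]
      refine ⟨by simp, fun z => ?_⟩
      obtain ⟨n, hn⟩ := hf z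
      exact reach13_congr x f _ (fun w hw => Function.update_of_ne hw _ _) n z hn
    · simp
  · rintro ⟨y, t⟩ h
    exact weight13 r x y t

lemma pred13 {X : Type*} (f : X → X) (x y y' : X) (i j : ℕ) (hi : f^[i] x = y)
    (hj : f^[j] x = y') (hy : f y = x) (hy' : f y' = x) : y = y' := by
  have hpi : f^[i+1] x = x := by rw [Function.iterate_succ_apply', hi, hy]
  have hpj : f^[j+1] x = x := by rw [Function.iterate_succ_apply', hj, hy']
  have e1 : f^[i + (i+1) * j] x = y := by
    rw [Function.iterate_add_apply, Function.iterate_mul, Function.iterate_fixed hpi, hi]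
  have e2 : f^[j + (j+1) * i] x = y' := by
    rw [Function.iterate_add_apply, Function.iterate_mul, Function.iterate_fixed hpj, hj]
  rw [← e1, ← e2, show i + (i+1) * j = j + (j+1) * i by ring]

lemma in13 {X : Type*} [Fintype X] (r : X × X → ℝ) (x : X) :
    ∑ y, r (y, x) * tau r y ∅ ∅ = ∑ f : X → X with Reach13 x f, ∏ z, r (z, f z) := by
  simp_rw [tau13, Finset.mul_sum]
  rw [Finset.sum_sigma']
  refine Finset.sum_bij (fun q _ => Function.update q.2 q.1 x) ?_ ?_ ?_ ?_
  · rintro ⟨y, t⟩ h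
    simp only [Finset.mem_sigma, Finset.mem_univ, Finset.mem_filter, true_and] at h ⊢
    intro z
    obtain ⟨n, hn⟩ := h.2 z
    obtain ⟨m, hm⟩ := reach13_congr y t (Function.update t y x)
      (fun w hw => Function.update_of_ne hw _ _) n z hn
    exact ⟨m + 1, by rw [Function.iterate_succ_apply', hm, Function.update_self]⟩
  · rintro ⟨y, t⟩ h ⟨y', t'⟩ h' he
    simp only [Finset.mem_sigma, Finset.mem_univ, Finset.mem_filter, true_and] at h h' he
    obtain ⟨n, hn⟩ := h.2 x
    obtain ⟨i, hi⟩ := reach13_congr y t (Function.update t y x)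
      (fun w hw => Function.update_of_ne hw _ _) n x hn
    obtain ⟨n', hn'⟩ := h'.2 x
    obtain ⟨j, hj⟩ := reach13_congr y' t' (Function.update t' y' x)
      (fun w hw => Function.update_of_ne hw _ _) n' x hn'
    have hyy : y = y' := by
      refine pred13 (Function.update t y x) x y y' i j hi ?_ (Function.update_self ..) ?_
      · rw [he]; exact hj
      · rw [he]; exact Function.update_self ..
    subst hyy
    have : t = t' := by
      funext z
      by_cases hz : z = y
      · subst hz; exact h.1.trans h'.1.symm
      · have := congrFun he z
        simpa [Function.update_of_ne hz] using this
    rw [this]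
  · intro f hf
    simp only [Finset.mem_filter, Finset.mem_univ, true_and] at hf
    obtain ⟨n, hn⟩ := hf (f x)
    have hfy : f (f^[n] x) = x := by
      rw [← Function.iterate_succ_apply' f n x, Function.iterate_succ_apply, hn]
    refine ⟨⟨f^[n] x, Function.update f (f^[n] x) (f^[n] x)⟩, ?_, ?_⟩
    · simp only [Finset.mem_sigma, Finset.mem_univ, Finset.mem_filter, true_and]
      refine ⟨by simp, fun z => ?_⟩
      obtain ⟨k, hk⟩ := hf z
      refine reach13_congr (f^[n] x) f _ (fun w hw => Function.update_of_ne hw _ _) (n + k) z ?_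
      rw [Function.iterate_add_apply, hk]
    · funext z
      by_cases hz : z = f^[n] x
      · subst hz; simp [hfy]
      · simp [Function.update_of_ne hz]
  · rintro ⟨y, t⟩ h
    exact weight13 r y x t

lemma tau_nonneg13 {X : Type*} [Fintype X] (r : X × X → ℝ) (hr : ∀ e, 0 ≤ r e) (x : X) :
    0 ≤ tau r x ∅ ∅ := by
  rw [tau13]
  exact Finset.sum_nonneg fun t _ => Finset.prod_nonneg fun y _ => hr _

lemma tau_pos13 {X : Type*} [Fintype X] (r : X × X → ℝ) (hr : ∀ e, 0 ≤ r e)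
    (hirr : Irreducible' r) (a : X) : 0 < tau r a ∅ ∅ := by
  let D : ℕ → X → Prop := fun n y => ∃ f : ℕ → X,
    f 0 = y ∧ f n = a ∧ ∀ i < n, 0 < r (f i, f (i + 1))
  have hD : ∀ y, ∃ n, D n y := by
    intro y
    by_cases h : y = a
    · exact ⟨0, fun _ => a, h.symm, rfl, by simp⟩
    · exact hirr y a h
  let d : X → ℕ := fun y => Nat.find (hD y)
  have step : ∀ y, ∃ z, y ≠ a → 0 < r (y, z) ∧ d z < d y := by
    intro y
    by_cases hy : y = a
    · exact ⟨a, fun h => absurd hy h⟩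
    have hs : D (d y) y := Nat.find_spec (hD y)
    obtain ⟨f, h0, hn, hp⟩ := hs
    rcases hk : d y with _ | k
    · rw [hk, h0] at hn; exact absurd hn hy
    rw [hk] at hn hp
    refine ⟨f 1, fun _ => ⟨?_, ?_⟩⟩
    · have := hp 0 (by omega); rwa [h0] at this
    · have : D k (f 1) := ⟨fun i => f (i + 1), rfl, hn, fun i hi => hp (i + 1) (by omega)⟩
      exact Nat.lt_succ_of_le (Nat.find_min' (hD (f 1)) this)
  choose s hs using step
  let t := Function.update s a a
  have ht : ∀ y, y ≠ a → t y = s y := fun y hy => Function.update_of_ne hy _ _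
  have hreach : ∀ k y, d y ≤ k → ∃ n : ℕ, t^[n] y = a := by
    intro k
    induction k with
    | zero =>
      intro y hy
      by_cases h : y = a
      · exact ⟨0, h⟩
      · have := (hs y h).2; omega
    | succ k ih =>
      intro y hy
      by_cases h : y = a
      · exact ⟨0, h⟩
      · have := (hs y h).2
        obtain ⟨n, hn⟩ := ih (s y) (by omega)
        exact ⟨n + 1, by rw [Function.iterate_succ_apply, ht y h, hn]⟩
  rw [tau13]
  refine Finset.sum_pos' (fun t _ => Finset.prod_nonneg fun y _ => hr _) ⟨t, ?_, ?_⟩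
  · simp only [Finset.mem_filter, Finset.mem_univ, true_and]
    exact ⟨Function.update_self .., fun y => hreach _ y le_rfl⟩
  · refine Finset.prod_pos fun y hy => ?_
    have hy' : y ≠ a := by simpa using hy
    rw [ht y hy']
    exact (hs y hy').1

lemma uniq13 {X : Type*} [Fintype X] [Nonempty X] (r : X × X → ℝ) (hr : ∀ e, 0 ≤ r e)
    (hirr : Irreducible' r) (z : X → ℝ)
    (hz : ∀ x, ∑ y, r (y, x) * z y = ∑ y, r (x, y) * z x) (hs : ∑ x, z x = 0) :
    ∀ x, z x = 0 := by
  have hle : ∀ x ∈ Finset.univ, ∑ y, r (x, y) * max (z x) 0 ≤ ∑ y, r (y, x) * max (z y) 0 := by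
    intro x _
    rcases le_total (z x) 0 with h | h
    · simp only [max_eq_right h, mul_zero, Finset.sum_const_zero]
      exact Finset.sum_nonneg fun y _ => mul_nonneg (hr _) (le_max_right _ _)
    · rw [max_eq_left h, ← hz x]
      exact Finset.sum_le_sum fun y _ => mul_le_mul_of_nonneg_left (le_max_left _ _) (hr _)
  have heq := (Finset.sum_eq_sum_iff_of_le hle).1 Finset.sum_comm
  have hback : ∀ x y, max (z x) 0 = 0 → 0 < r (y, x) → max (z y) 0 = 0 := by
    intro x y hx hy
    have h := heq x (Finset.mem_univ x)
    simp only [hx, mul_zero, Finset.sum_const_zero] at h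
    have := (Finset.sum_eq_zero_iff_of_nonneg
      (fun y _ => mul_nonneg (hr (y, x)) (le_max_right (z y) 0))).1 h.symm y (Finset.mem_univ y)
    rcases mul_eq_zero.1 this with h | h
    · exact absurd h hy.ne'
    · exact h
  have hpath : ∀ x y, max (z x) 0 = 0 → max (z y) 0 = 0 := by
    intro x y hx
    by_cases hxy : y = x
    · rw [hxy, hx]
    obtain ⟨n, f, h0, hn, hp⟩ := hirr y x hxy
    have : ∀ k ≤ n, max (z (f (n - k))) 0 = 0 := by
      intro k
      induction k with
      | zero => intro _; simpa [hn] using hx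
      | succ k ih =>
        intro hk
        refine hback _ _ (ih (by omega)) ?_
        have := hp (n - (k + 1)) (by omega)
        rwa [show n - (k + 1) + 1 = n - k by omega] at this
    have h := this n le_rfl
    rwa [Nat.sub_self, h0] at h
  by_cases hall : ∃ x, max (z x) 0 = 0
  · obtain ⟨x, hx⟩ := hall
    have hn : ∀ y ∈ Finset.univ, z y ≤ 0 := fun y _ => max_eq_right_iff.1 (hpath x y hx)
    intro y
    exact (Finset.sum_eq_zero_iff_of_nonpos hn).1 hs y (Finset.mem_univ y)
  · push Not at hall
    have hpos : 0 < ∑ x, z x := Finset.sum_pos (fun x _ => by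
      by_contra h
      exact hall x (max_eq_right (not_lt.1 h))) Finset.univ_nonempty
    exact absurd hs hpos.ne'

def pi13 {X : Type*} [Fintype X] (r : X × X → ℝ) (x : X) : ℝ :=
  tau r x ∅ ∅ / ∑ y, tau r y ∅ ∅

lemma pi13_stat {X : Type*} [Fintype X] (r : X × X → ℝ) (x : X) :
    ∑ y, r (y, x) * pi13 r y = ∑ y, r (x, y) * pi13 r x := by
  unfold pi13
  simp_rw [← mul_div_assoc, ← Finset.sum_div]
  rw [in13, out13]

lemma current13 {X : Type*} [Fintype X] (r : X × X → ℝ) (u v : X) :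
    current r u v = r (u, v) * pi13 r u - r (v, u) * pi13 r v := by
  unfold current pi13
  ring

lemma rate13 {X : Type*} (r : X × X → ℝ) (a b : X) (hab : a ≠ b) (p m : ℝ) (x y : X) :
    ratePM r a b p m (x, y) = ratePM r a b 0 0 (x, y)
      + (if y = b then (if x = a then p else 0) else 0)
      + (if y = a then (if x = b then m else 0) else 0) := by
  unfold ratePM
  simp only [Prod.mk.injEq]
  by_cases h1 : x = a <;> by_cases h2 : y = b <;> by_cases h3 : x = b <;>
    by_cases h4 : y = a <;> simp_all

/-- Stationarity in terms of the reduced rates. -/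
lemma red13 {X : Type*} [Fintype X] (r : X × X → ℝ) (a b : X) (hab : a ≠ b) (p m : ℝ) (x : X) :
    ∑ y, ratePM r a b 0 0 (y, x) * pi13 (ratePM r a b p m) y
      - ∑ y, ratePM r a b 0 0 (x, y) * pi13 (ratePM r a b p m) x
      = ((if x = a then 1 else 0) - (if x = b then 1 else 0))
        * current (ratePM r a b p m) a b := by
  have h := pi13_stat (ratePM r a b p m) x
  have c : current (ratePM r a b p m) a b = p * pi13 (ratePM r a b p m) a
      - m * pi13 (ratePM r a b p m) b := by
    rw [current13]; simp [ratePM, hab, hab.symm]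
  rw [c]
  generalize pi13 (ratePM r a b p m) = q at *
  simp_rw [rate13 r a b hab p m, add_mul, Finset.sum_add_distrib] at h
  by_cases h1 : x = a
  · subst h1
    simp [hab] at h ⊢
    linarith
  · by_cases h2 : x = b
    · subst h2
      simp [hab.symm] at h ⊢
      linarith
    · simp [h1, h2] at h ⊢
      linarith

theorem stmt_13 {X : Type*} [Fintype X] (r : X × X → ℝ) (a b : X) (hab : a ≠ b)
    (hr : ∀ e, e ≠ (a, b) → e ≠ (b, a) → 0 ≤ r e)
    (hirr : Irreducible' (ratePM r a b 0 0))
    (u v : X) (huv : u ≠ v) :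
    ∃ lam0 lam1 : ℝ, ∀ p m : ℝ, 0 ≤ p → 0 ≤ m →
      current (ratePM r a b p m) u v =
        lam0 + lam1 * current (ratePM r a b p m) a b := by
  have : Nonempty X := ⟨a⟩
  by_cases he : u = a ∧ v = b
  · obtain ⟨rfl, rfl⟩ := he
    exact ⟨0, 1, fun p m _ _ => by ring⟩
  by_cases he' : u = b ∧ v = a
  · obtain ⟨rfl, rfl⟩ := he'
    exact ⟨0, -1, fun p m _ _ => by rw [current13, current13]; ring⟩
  have hnn : ∀ p m : ℝ, 0 ≤ p → 0 ≤ m → ∀ e, 0 ≤ ratePM r a b p m e := by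
    intro p m hp hm e
    unfold ratePM
    split_ifs with h1 h2
    exacts [hp, hm, hr e h1 h2]
  have hirr' : ∀ p m : ℝ, 0 ≤ p → 0 ≤ m → Irreducible' (ratePM r a b p m) := by
    intro p m hp hm x y hxy
    obtain ⟨n, f, h0, hn, hpos⟩ := hirr x y hxy
    refine ⟨n, f, h0, hn, fun i hi => lt_of_lt_of_le (hpos i hi) ?_⟩
    unfold ratePM
    split_ifs
    exacts [hp, hm, le_rfl]
  have hsum : ∀ p m : ℝ, 0 ≤ p → 0 ≤ m → ∑ x, pi13 (ratePM r a b p m) x = 1 := by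
    intro p m hp hm
    unfold pi13
    rw [← Finset.sum_div]
    apply div_self
    exact (Finset.sum_pos (fun x _ => tau_pos13 _ (hnn p m hp hm) (hirr' p m hp hm) x)
      Finset.univ_nonempty).ne'
  have key : ∃ w : X → ℝ, ∀ p m : ℝ, 0 ≤ p → 0 ≤ m → ∀ x,
      pi13 (ratePM r a b p m) x = pi13 (ratePM r a b 0 0) x
        + current (ratePM r a b p m) a b * w x := by
    have c0 : current (ratePM r a b 0 0) a b = 0 := by
      rw [current13]; simp [ratePM]
    by_cases hex : ∃ p m : ℝ, 0 ≤ p ∧ 0 ≤ m ∧ current (ratePM r a b p m) a b ≠ 0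
    · obtain ⟨p', m', hp', hm', hj⟩ := hex
      refine ⟨fun x => (pi13 (ratePM r a b p' m') x - pi13 (ratePM r a b 0 0) x)
        / current (ratePM r a b p' m') a b, fun p m hp hm x => ?_⟩
      have e := red13 r a b hab p m
      have e' := red13 r a b hab p' m'
      have e0 := red13 r a b hab 0 0
      have s := hsum p m hp hm
      have s' := hsum p' m' hp' hm'
      have s0 := hsum 0 0 le_rfl le_rfl
      rw [c0] at e0
      set j := current (ratePM r a b p m) a b
      set j' := current (ratePM r a b p' m') a b
      set q := pi13 (ratePM r a b p m)
      set q' := pi13 (ratePM r a b p' m')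
      set q0 := pi13 (ratePM r a b 0 0)
      have := uniq13 (ratePM r a b 0 0) (hnn 0 0 le_rfl le_rfl) hirr
        (fun x => j' * (q x - q0 x) - j * (q' x - q0 x)) (by
          intro x
          have e := e x
          have e' := e' x
          have e0 := e0 x
          simp only [mul_sub, mul_left_comm _ j', mul_left_comm _ j, Finset.sum_sub_distrib,
            ← Finset.mul_sum]
          linear_combination j' * e - j * e' + (j - j') * e0) (by
          simp only [Finset.sum_sub_distrib, ← Finset.mul_sum, s, s', s0]
          ring) x
      field_simp
      linarith
    · push Not at hex
      refine ⟨fun _ => 0, fun p m hp hm x => ?_⟩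
      have e := red13 r a b hab p m
      have e0 := red13 r a b hab 0 0
      have s := hsum p m hp hm
      have s0 := hsum 0 0 le_rfl le_rfl
      rw [c0] at e0
      rw [hex p m hp hm] at e
      have := uniq13 (ratePM r a b 0 0) (hnn 0 0 le_rfl le_rfl) hirr
        (fun x => pi13 (ratePM r a b p m) x - pi13 (ratePM r a b 0 0) x) (by
          intro x
          have e := e x
          have e0 := e0 x
          simp only [mul_sub, Finset.sum_sub_distrib]
          linear_combination e - e0) (by
          rw [Finset.sum_sub_distrib, s, s0, sub_self]) x
      linarith
  obtain ⟨w, hw⟩ := key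
  refine ⟨r (u, v) * pi13 (ratePM r a b 0 0) u - r (v, u) * pi13 (ratePM r a b 0 0) v,
    r (u, v) * w u - r (v, u) * w v, fun p m hp hm => ?_⟩
  have r1 : ratePM r a b p m (u, v) = r (u, v) := by
    unfold ratePM
    rw [if_neg (by simpa using he), if_neg (by simpa using he')]
  have r2 : ratePM r a b p m (v, u) = r (v, u) := by
    unfold ratePM
    rw [if_neg (by simp only [Prod.mk.injEq]; tauto), if_neg (by simp only [Prod.mk.injEq]; tauto)]
  rw [current13 _ u v, r1, r2, hw p m hp hm u, hw p m hp hm v]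
  ring
end
end
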